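/- arXiv:math/0605227 — 2 statements merged into one kernel-verified Lean document; each statement's English description precedes it below -/
import Mathlib

section
/- Let p and q be odd primes, m ≥ 1, and let x, y be coprime positive integers with x² + q^(2m) = 2·y^p. Suppose there exist integers u, v with y = u² + v², x = F_p(u,v), q^m = G_p(u,v), and u + δ4·v = q^m or u + δ4·v = −q^m. Then: if m ≥ 40 then p ≤ 1309; if m ≥ 100 then p ≤ 1093; and if m ≥ 250 then p ≤ 1009. -/
/-- `δ₄ = 1` if `p ≡ 1 (mod 4)` and `δ₄ = -1` if `p ≡ 3 (mod 4)`. -/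
def d4 (p : ℕ) : ℤ := if p % 4 = 1 then 1 else -1

/-- `δ₈ = 1` if `p ≡ 1, 3 (mod 8)` and `δ₈ = -1` if `p ≡ 5, 7 (mod 8)`. -/
def d8 (p : ℕ) : ℤ := if p % 8 = 1 ∨ p % 8 = 3 then 1 else -1

/-- `F_p(u,v) = Re((1+i)(u+iv)^p)`. -/
def Ffun (p : ℕ) (u v : ℤ) : ℤ :=
  ((⟨1, 1⟩ : GaussianInt) * (⟨u, v⟩ : GaussianInt) ^ p).re

/-- `G_p(u,v) = Im((1+i)(u+iv)^p)`. -/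
def Gfun (p : ℕ) (u v : ℤ) : ℤ :=
  ((⟨1, 1⟩ : GaussianInt) * (⟨u, v⟩ : GaussianInt) ^ p).im

/-- `H_p(u,v) = G_p(u,v)/(u + δ₄ v)` (exact division whenever `u + δ₄ v ≠ 0`). -/
def Hfun (p : ℕ) (u v : ℤ) : ℤ := Gfun p u v / (u + d4 p * v)

/-! Divided differences -/

/-- Divided difference of the values `g` at the nodes `t a, ..., t (a+n)`. -/
noncomputable def ddf {E : Type*} [AddCommGroup E] [Module ℝ E] (t : ℕ → ℝ) (g : ℕ → E) :
    ℕ → ℕ → E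
  | 0, a => g a
  | n + 1, a => (t (a + n + 1) - t a)⁻¹ • (ddf t g n (a + 1) - ddf t g n a)

lemma ddf_add {E : Type*} [AddCommGroup E] [Module ℝ E] (t : ℕ → ℝ) (g e : ℕ → E) (n a : ℕ) :
    ddf t (fun i => g i + e i) n a = ddf t g n a + ddf t e n a := by
  induction n generalizing a with
  | zero => rfl
  | succ n ih => simp only [ddf, ih]; rw [← smul_add]; congr 1; abel

lemma ddf_map {E F : Type*} [AddCommGroup E] [Module ℝ E] [AddCommGroup F] [Module ℝ F]
    (L : E →ₗ[ℝ] F) (t : ℕ → ℝ) (g : ℕ → E) (n a : ℕ) :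
    ddf t (fun i => L (g i)) n a = L (ddf t g n a) := by
  induction n generalizing a with
  | zero => rfl
  | succ n ih => simp only [ddf, ih, map_smul, map_sub]

lemma ddf_newton {E : Type*} [AddCommGroup E] [Module ℝ E] (t : ℕ → ℝ) (g : ℕ → E) (d : ℕ) :
    ∀ a, (∀ i j, a ≤ i → i < j → j ≤ a + d → t i ≠ t j) →
    g (a + d) = ∑ n ∈ Finset.range (d + 1),
      (∏ l ∈ Finset.range n, (t (a + d) - t (a + l))) • ddf t g n a := by
  induction d with
  | zero => intro a _; simp [ddf]
  | succ d ih =>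
    intro a hinj
    have h1 := ih (a + 1) (fun i j hi hij hj => hinj i j (by omega) hij (by omega))
    have e1 : a + 1 + d = a + (d + 1) := by ring
    rw [e1] at h1
    rw [h1]
    set x := t (a + (d + 1)) with hx
    have key : ∀ n ∈ Finset.range (d + 1),
        (∏ l ∈ Finset.range n, (x - t (a + 1 + l))) • ddf t g n (a + 1) =
        ((∏ l ∈ Finset.range n, (x - t (a + 1 + l))) • ddf t g n a -
          (∏ l ∈ Finset.range (n + 1), (x - t (a + 1 + l))) • ddf t g (n + 1) a) +
          (∏ l ∈ Finset.range (n + 1), (x - t (a + l))) • ddf t g (n + 1) a := by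
      intro n hn
      rw [Finset.mem_range] at hn
      have hne : t (a + n + 1) - t a ≠ 0 :=
        sub_ne_zero.mpr (hinj a (a + n + 1) le_rfl (by omega) (by omega)).symm
      have h2 : ddf t g n (a + 1) = ddf t g n a + (t (a + n + 1) - t a) • ddf t g (n + 1) a := by
        simp only [ddf]
        rw [smul_smul, mul_inv_cancel₀ hne, one_smul]; abel
      rw [h2, Finset.prod_range_succ (fun l => x - t (a + 1 + l)),
        Finset.prod_range_succ' (fun l => x - t (a + l))]
      have e2 : a + 1 + n = a + n + 1 := by ring
      have e3 : ∀ l ∈ Finset.range n, x - t (a + (l + 1)) = x - t (a + 1 + l) :=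
        fun l _ => by rw [add_assoc a 1 l, add_comm 1 l]
      rw [Finset.prod_congr rfl e3, e2, add_zero]
      module
    rw [Finset.sum_congr rfl key, Finset.sum_add_distrib, Finset.sum_range_sub',
      Finset.sum_range_succ' _ (d + 1)]
    have hz : ∏ l ∈ Finset.range (d + 1), (x - t (a + 1 + l)) = 0 := by
      apply Finset.prod_eq_zero (i := d) (by simp)
      rw [e1, hx, sub_self]
    rw [hz]
    simp only [Finset.range_zero, Finset.prod_empty, zero_smul, sub_zero]
    rw [add_comm]

lemma ddf_bound_sep (t : ℕ → ℝ) (e : ℕ → ℂ) (N : ℕ) (ε : ℝ) (hε : 0 ≤ ε) (H : ℕ → ℝ)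
    (hH : ∀ d, 0 < d → 0 < H d)
    (he : ∀ i, i < N → ‖e i‖ ≤ ε) (ht : ∀ a d, 0 < d → a + d < N → H d ≤ t (a + d) - t a) (n : ℕ) :
    ∀ a, a + n < N → ‖ddf t e n a‖ ≤ ε * 2 ^ n / ∏ d ∈ Finset.range n, H (d + 1) := by
  induction n with
  | zero => intro a ha; simpa [ddf] using he a (by omega)
  | succ n ih =>
    intro a ha
    have h1 := ih (a + 1) (by omega)
    have h2 := ih a (by omega)
    have h3 := ht a (n + 1) (by omega) (by omega)
    have h4 := hH (n + 1) (by omega)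
    have hP : 0 < ∏ d ∈ Finset.range n, H (d + 1) := Finset.prod_pos fun d _ => hH _ (by omega)
    simp only [ddf]
    rw [norm_smul, norm_inv, Real.norm_eq_abs]
    have h5 : 0 < t (a + n + 1) - t a := lt_of_lt_of_le h4 h3
    rw [abs_of_pos h5, Finset.prod_range_succ]
    have h6 : ‖ddf t e n (a + 1) - ddf t e n a‖ ≤
        2 * (ε * 2 ^ n / ∏ d ∈ Finset.range n, H (d + 1)) := by
      refine (norm_sub_le _ _).trans ?_
      linarith
    have h7 : (t (a + n + 1) - t a)⁻¹ ≤ (H (n + 1))⁻¹ := inv_anti₀ h4 h3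
    calc (t (a + n + 1) - t a)⁻¹ * ‖ddf t e n (a + 1) - ddf t e n a‖
        ≤ (H (n + 1))⁻¹ * (2 * (ε * 2 ^ n / ∏ d ∈ Finset.range n, H (d + 1))) := by gcongr
      _ = _ := by rw [pow_succ]; field_simp

lemma rolle_iter (m : ℕ) : ∀ (F : ℕ → ℝ → ℝ) (_ : ∀ k x, HasDerivAt (F k) (F (k + 1) x) x)
    (s : ℕ → ℝ) (_ : ∀ i, i < m → s i < s (i + 1)) (_ : ∀ i, i ≤ m → F 0 (s i) = 0),
    ∃ ξ, F m ξ = 0 := by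
  induction m with
  | zero => intro F _ s _ h; exact ⟨s 0, h 0 le_rfl⟩
  | succ m ih =>
    intro F hF s hs hz
    have h1 : ∀ i, ∃ c, i ≤ m → (c ∈ Set.Ioo (s i) (s (i + 1)) ∧ F 1 c = 0) := by
      intro i
      by_cases hi : i ≤ m
      · obtain ⟨c, hc, hc2⟩ := exists_hasDerivAt_eq_zero (f := F 0) (f' := F 1) (hs i (by omega))
          (fun x _ => (hF 0 x).continuousAt.continuousWithinAt)
          (by rw [hz i (by omega), hz (i + 1) (by omega)]) (fun x _ => hF 0 x)
        exact ⟨c, fun _ => ⟨hc, hc2⟩⟩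
      · exact ⟨0, fun h => absurd h hi⟩
    choose c hc using h1
    obtain ⟨ξ, hξ⟩ := ih (fun k => F (k + 1)) (fun k x => hF (k + 1) x) c
      (fun i hi => by
        have h2 := (hc i (by omega)).1
        have h3 := (hc (i + 1) (by omega)).1
        exact h2.2.trans h3.1)
      (fun i hi => (hc i hi).2)
    exact ⟨ξ, hξ⟩

open Polynomial in
lemma ddf_cos_bound (t : ℕ → ℝ) (c b : ℝ) (hc : 0 ≤ c) (m a : ℕ)
    (ht : ∀ i j, a ≤ i → i < j → j ≤ a + m → t i < t j) :
    |ddf t (fun i => Real.cos (c * t i + b)) m a| ≤ c ^ m / m.factorial := by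
  set g : ℕ → ℝ := fun i => Real.cos (c * t i + b) with hg
  let P : ℝ[X] := ∑ n ∈ Finset.range (m + 1),
    C (ddf t g n a) * ∏ l ∈ Finset.range n, (X - C (t (a + l)))
  have hdeg : ∀ n, (∏ l ∈ Finset.range n, (X - C (t (a + l)) : ℝ[X])).natDegree = n := by
    intro n
    rw [natDegree_prod_of_monic _ _ (fun i _ => monic_X_sub_C _)]; simp
  have hmon : ∀ n, (∏ l ∈ Finset.range n, (X - C (t (a + l)) : ℝ[X])).Monic := fun n =>
    monic_prod_of_monic _ _ (fun i _ => monic_X_sub_C _)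
  have hPeval : ∀ i, i ≤ m → P.eval (t (a + i)) = g (a + i) := by
    intro i hi
    rw [ddf_newton t g i a (fun i' j h1 h2 h3 => (ht i' j h1 h2 (by omega)).ne)]
    simp only [P, eval_finsetSum, eval_mul, eval_C, eval_prod, eval_sub, eval_X, smul_eq_mul]
    symm
    have : Finset.range (i + 1) ⊆ Finset.range (m + 1) := by
      intro x; simp; omega
    rw [← Finset.sum_subset this]
    · apply Finset.sum_congr rfl; intros; ring
    · intro x hx hx2
      simp at hx hx2
      rw [Finset.prod_eq_zero (i := i) (by simp; omega) (by simp)]; simp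
  have hPder : derivative^[m] P = C (m.factorial * ddf t g m a) := by
    simp only [P]
    rw [Finset.sum_range_succ, iterate_map_add, iterate_derivative_sum,
      Finset.sum_eq_zero, zero_add, iterate_derivative_C_mul]
    · have h1 := hdeg m
      have h2 := hmon m
      set Q := (∏ l ∈ Finset.range m, (X - C (t (a + l)) : ℝ[X]))
      have : derivative^[m] Q = C (m.factorial : ℝ) := by
        ext k
        rw [coeff_iterate_derivative]
        rcases Nat.eq_zero_or_pos k with rfl | hk
        · rw [zero_add, Nat.descFactorial_self]
          have : Q.coeff m = 1 := by have := h2.coeff_natDegree; rwa [h1] at this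
          rw [this]; simp
        · rw [coeff_eq_zero_of_natDegree_lt (by omega), coeff_C, if_neg (by omega)]; simp
      rw [this, ← C_mul, mul_comm]
    · intro n hn
      rw [iterate_derivative_C_mul, iterate_derivative_eq_zero, mul_zero]
      rw [hdeg]; simpa using hn
  let F : ℕ → ℝ → ℝ := fun k x =>
    c ^ k * Real.cos (c * x + b + k * (Real.pi / 2)) - (derivative^[k] P).eval x
  have hF : ∀ k x, HasDerivAt (F k) (F (k + 1) x) x := by
    intro k x
    simp only [F]
    apply HasDerivAt.sub
    · have h1 : HasDerivAt (fun x => c * x + b + k * (Real.pi / 2)) c x := by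
        have := ((hasDerivAt_id x).const_mul c).add_const b |>.add_const (k * (Real.pi / 2))
        simpa using this
      have h2 := (h1.cos).const_mul (c ^ k)
      refine h2.congr_deriv ?_
      have : c * x + b + ((k + 1 : ℕ) : ℝ) * (Real.pi / 2) =
        (c * x + b + k * (Real.pi / 2)) + Real.pi / 2 := by push_cast; ring
      rw [this, Real.cos_add_pi_div_two]; ring
    · rw [Function.iterate_succ_apply']
      exact Polynomial.hasDerivAt _ _
  obtain ⟨ξ, hξ⟩ := rolle_iter m F hF (fun i => t (a + i))
    (fun i hi => ht _ _ (by omega) (by omega) (by omega))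
    (fun i hi => by simp [F, hPeval i hi, hg])
  simp only [F] at hξ
  rw [hPder, eval_C] at hξ
  have h3 : ddf t g m a =
      c ^ m * Real.cos (c * ξ + b + m * (Real.pi / 2)) / m.factorial := by
    rw [eq_div_iff (by positivity)]; linarith
  rw [h3, abs_div, abs_mul, abs_pow, abs_of_nonneg hc, Nat.abs_cast]
  gcongr
  exact mul_le_of_le_one_right (by positivity) (Real.abs_cos_le_one _)

lemma ddf_exp_bound (t : ℕ → ℝ) (c : ℝ) (hc : 0 ≤ c) (m a : ℕ)
    (ht : ∀ i j, a ≤ i → i < j → j ≤ a + m → t i < t j) :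
    ‖ddf t (fun i => Complex.exp ((c * t i : ℝ) * Complex.I)) m a‖ ≤ c ^ m / m.factorial := by
  set D := ddf t (fun i => Complex.exp ((c * t i : ℝ) * Complex.I)) m a with hD
  set b : ℝ := - Complex.arg D
  let L : ℂ →ₗ[ℝ] ℝ := Complex.reLm.comp (LinearMap.mulLeft ℝ (Complex.exp (b * Complex.I)))
  have h1 := ddf_map L t (fun i => Complex.exp ((c * t i : ℝ) * Complex.I)) m a
  have h2 : L D = ‖D‖ := by
    simp only [L, LinearMap.comp_apply, LinearMap.mulLeft_apply, Complex.reLm_coe]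
    conv_lhs => rw [← Complex.norm_mul_exp_arg_mul_I D]
    rw [mul_left_comm, ← Complex.exp_add]
    simp [b]
  have h3 : (fun i => L (Complex.exp ((c * t i : ℝ) * Complex.I))) =
      fun i => Real.cos (c * t i + b) := by
    funext i
    simp only [L, LinearMap.comp_apply, LinearMap.mulLeft_apply, Complex.reLm_coe]
    rw [← Complex.exp_add, ← add_mul, ← Complex.ofReal_add, Complex.exp_ofReal_mul_I_re, add_comm]
  rw [← hD, h2, h3] at h1
  rw [← h1]
  exact (le_abs_self _).trans (ddf_cos_bound t c b hc m a ht)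
/-! Determinants -/

open Polynomial in
/-- The generalized Vandermonde matrix with columns `P_k(t)` and `P_k(t) g`. -/
noncomputable def matG (K : ℕ) (t : ℕ → ℂ) (g : ℕ → ℂ) (P : ℕ → ℂ[X]) :
    Matrix (Fin K ⊕ Fin K) (Fin K ⊕ Fin K) ℂ :=
  Matrix.of fun i j => Sum.elim (fun k : Fin K => (P k).eval (t (finSumFinEquiv i : ℕ)))
    (fun k : Fin K => (P k).eval (t (finSumFinEquiv i : ℕ)) * g (finSumFinEquiv i : ℕ)) j

open Polynomial in
lemma det_matG_monic (K : ℕ) (t : ℕ → ℂ) (g : ℕ → ℂ) (P : ℕ → ℂ[X])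
    (hd : ∀ k, (P k).natDegree = k) (hm : ∀ k, (P k).Monic) :
    (matG K t g P).det = (matG K t g (fun k => X ^ k)).det := by
  let A : Matrix (Fin K) (Fin K) ℂ := Matrix.of (fun (i j : Fin K) => (P j).coeff i)
  have hA : A.det = 1 := Matrix.det_matrixOfPolynomials (fun i : Fin K => P i)
    (fun i => hd i) (fun i => hm i)
  have hev : ∀ (x : ℂ) (k : Fin K), (P k).eval x = ∑ j : Fin K, x ^ (j : ℕ) * A j k := by
    intro x k
    rw [eval_eq_sum_range' (n := K) (by rw [hd]; exact k.2),
      ← Fin.sum_univ_eq_sum_range (fun i => (P k).coeff i * x ^ i)]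
    exact Finset.sum_congr rfl fun j _ => mul_comm _ _
  have h : matG K t g P = matG K t g (fun k => X ^ k) * Matrix.fromBlocks A 0 0 A := by
    ext i j
    rw [Matrix.mul_apply, Fintype.sum_sum_type]
    rcases j with k | k
    · simp [matG, hev]
    · simp only [matG, Matrix.of_apply, Sum.elim_inr, hev, Sum.elim_inl, Matrix.fromBlocks_apply₁₂,
        Matrix.fromBlocks_apply₂₂, Matrix.zero_apply, mul_zero, Finset.sum_const_zero, zero_add,
        eval_pow, eval_X, Finset.sum_mul]
      exact Finset.sum_congr rfl fun j _ => by ring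
  rw [h, Matrix.det_mul, Matrix.det_fromBlocks_zero₂₁, hA]; simp

lemma det_scaled_bound {n : ℕ} (D : Matrix (Fin n) (Fin n) ℂ) (X : ℝ) (u : ℝ) (hu : 0 < u)
    (h : ∀ i j, ‖D i j‖ ≤ X * (u ^ (i : ℕ) / u ^ (j : ℕ))) :
    ‖D.det‖ ≤ n.factorial * X ^ n := by
  rw [Matrix.det_apply]
  refine (norm_sum_le _ _).trans ?_
  have : ∀ σ ∈ (Finset.univ : Finset (Equiv.Perm (Fin n))),
      ‖Equiv.Perm.sign σ • ∏ i, D (σ i) i‖ ≤ X ^ n := by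
    intro σ _
    have h1 : ‖Equiv.Perm.sign σ • ∏ i, D (σ i) i‖ = ∏ i, ‖D (σ i) i‖ := by
      rw [← norm_prod]
      rcases Int.units_eq_one_or (Equiv.Perm.sign σ) with h | h <;> rw [h] <;> simp
    rw [h1]
    calc ∏ i, ‖D (σ i) i‖ ≤ ∏ i : Fin n, (X * (u ^ ((σ i : Fin n) : ℕ) / u ^ (i : ℕ))) :=
          Finset.prod_le_prod (fun _ _ => norm_nonneg _) (fun i _ => h _ _)
      _ = X ^ n := by
          rw [Finset.prod_mul_distrib, Finset.prod_div_distrib,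
            Equiv.prod_comp σ (fun i : Fin n => u ^ (i : ℕ)), div_self, mul_one]
          · simp
          · exact Finset.prod_ne_zero_iff.mpr fun i _ => by positivity
  refine (Finset.sum_le_sum this).trans ?_
  simp [Finset.card_univ, Fintype.card_perm]

open Polynomial in
lemma vandermonde_bound (N : ℕ) (t : Fin N → ℝ) (x₀ B : ℝ) (hB : 0 < B)
    (ht : ∀ i, |t i - x₀| ≤ B) :
    |(Matrix.vandermonde t).det| ≤ N.factorial * ∏ n : Fin N, (2 * (B / 2) ^ (n : ℕ)) := by
  let Y : ℝ[X] := C B⁻¹ * (X - C x₀)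
  have hYd : Y.natDegree = 1 := by
    simp only [Y]
    rw [natDegree_C_mul (by positivity), natDegree_X_sub_C]
  have hYl : Y.leadingCoeff = B⁻¹ := by
    simp only [Y]
    rw [leadingCoeff_mul, leadingCoeff_C, leadingCoeff_X_sub_C, mul_one]
  let τ : Fin N → ℝ[X] := fun n => if (n : ℕ) = 0 then 1 else
    C (2 * (B / 2) ^ (n : ℕ)) * (Chebyshev.T ℝ (n : ℕ)).comp Y
  have hd : ∀ n, (τ n).natDegree = n := by
    intro n
    simp only [τ]
    split_ifs with h
    · simp [h]
    · rw [natDegree_C_mul (by positivity), natDegree_comp, hYd, Chebyshev.natDegree_T]; simp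
  have hm : ∀ n, (τ n).Monic := by
    intro n
    simp only [τ]
    split_ifs with h
    · exact monic_one
    · rw [Monic, leadingCoeff_mul, leadingCoeff_C, leadingCoeff_comp (by rw [hYd]; simp),
        Chebyshev.leadingCoeff_T, Chebyshev.natDegree_T, hYl]
      simp only [Int.natAbs_natCast]
      obtain ⟨k, hk⟩ := Nat.exists_eq_succ_of_ne_zero h
      rw [hk, Nat.succ_eq_add_one, Nat.add_sub_cancel, div_pow, inv_pow]
      field_simp
      ring
  have hb : ∀ i n, |(τ n).eval (t i)| ≤ 2 * (B / 2) ^ (n : ℕ) := by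
    intro i n
    simp only [τ]
    split_ifs with h
    · simp [h]
    · rw [eval_mul, eval_C, eval_comp, abs_mul, abs_of_pos (by positivity)]
      refine mul_le_of_le_one_right (by positivity) ?_
      have h1 : Y.eval (t i) = (t i - x₀) / B := by simp [Y]; ring
      have h2 : |(t i - x₀) / B| ≤ 1 := by
        rw [abs_div, abs_of_pos hB, div_le_one hB]; exact ht i
      rw [h1, ← Real.cos_arccos (abs_le.mp h2).1 (abs_le.mp h2).2, Chebyshev.T_real_cos]
      exact Real.abs_cos_le_one _
  rw [Matrix.det_eval_matrixOfPolynomials_eq_det_vandermonde t τ hd hm, Matrix.det_apply]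
  refine (Finset.abs_sum_le_sum_abs _ _).trans ?_
  have : ∀ σ ∈ (Finset.univ : Finset (Equiv.Perm (Fin N))),
      |Equiv.Perm.sign σ • ∏ i, Matrix.of (fun i j => (τ j).eval (t i)) (σ i) i| ≤
        ∏ n : Fin N, (2 * (B / 2) ^ (n : ℕ)) := by
    intro σ _
    have h1 : |Equiv.Perm.sign σ • ∏ i, Matrix.of (fun i j => (τ j).eval (t i)) (σ i) i| =
        ∏ i, |(τ i).eval (t (σ i))| := by
      rw [← Finset.abs_prod]
      rcases Int.units_eq_one_or (Equiv.Perm.sign σ) with h | h <;> rw [h] <;> simp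
    rw [h1]
    exact Finset.prod_le_prod (fun _ _ => abs_nonneg _) (fun i _ => hb _ _)
  refine (Finset.sum_le_sum this).trans ?_
  simp [Finset.card_univ, Fintype.card_perm]

open Polynomial in
lemma det_matG_factor (K : ℕ) (t : ℕ → ℝ) (g : ℕ → ℂ)
    (ht : ∀ i j, i < j → j < K + K → t i < t j) :
    (matG K (fun i => (t i : ℂ)) g (fun k => X ^ k)).det =
      ((Matrix.vandermonde (fun i : Fin (K + K) => t i)).det : ℂ) *
      (Matrix.of (fun n k : Fin K => ddf t g (K + n - k) k)).det := by
  let om : ℕ → ℂ[X] := fun n => ∏ l ∈ Finset.range n, (X - C ((t l : ℝ) : ℂ))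
  have hd : ∀ n, (om n).natDegree = n := by
    intro n
    simp only [om]
    rw [natDegree_prod_of_monic _ _ (fun i _ => monic_X_sub_C _)]; simp
  have hm : ∀ n, (om n).Monic := fun n => monic_prod_of_monic _ _ (fun i _ => monic_X_sub_C _)
  have hev : ∀ n x, (om n).eval x = ∏ l ∈ Finset.range n, (x - (t l : ℂ)) := by
    intro n x; simp [om, eval_prod]
  have hz : ∀ n i, i < n → (om n).eval (t i : ℂ) = 0 := by
    intro n i hi
    rw [hev, Finset.prod_eq_zero (i := i) (by simpa using hi) (by simp)]
  rw [← det_matG_monic K _ g om hd hm]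
  let W : Matrix (Fin K ⊕ Fin K) (Fin K ⊕ Fin K) ℂ := Matrix.of fun i j =>
    (om (finSumFinEquiv j : ℕ)).eval ((t (finSumFinEquiv i : ℕ) : ℝ) : ℂ)
  let D : Matrix (Fin K) (Fin K) ℂ := Matrix.of (fun n k : Fin K => ddf t g (K + n - k) k)
  let Xm : Matrix (Fin K) (Fin K) ℂ := Matrix.of (fun n k : Fin K =>
    if (k : ℕ) ≤ n then ddf t g (n - k) k else 0)
  have hW : W.det = ((Matrix.vandermonde (fun i : Fin (K + K) => t i)).det : ℂ) := by
    have h1 : W = (Matrix.of (fun i j : Fin (K + K) => (om j).eval ((t i : ℝ) : ℂ))).submatrix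
        finSumFinEquiv finSumFinEquiv := by ext i j; rfl
    rw [h1, Matrix.det_submatrix_equiv_self]
    rw [← Matrix.det_eval_matrixOfPolynomials_eq_det_vandermonde
      (fun i : Fin (K + K) => ((t i : ℝ) : ℂ)) (fun i => om i) (fun i => hd i) (fun i => hm i)]
    rw [Matrix.det_vandermonde, Matrix.det_vandermonde]
    push_cast
    rfl
  have hfac : matG K (fun i => (t i : ℂ)) g om = W * Matrix.fromBlocks 1 Xm 0 D := by
    ext i j
    rw [Matrix.mul_apply, Fintype.sum_sum_type]
    rcases j with k | k
    · simp [matG, W, Matrix.one_apply]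
    · simp only [matG, Matrix.of_apply, Sum.elim_inr, Matrix.fromBlocks_apply₁₂,
        Matrix.fromBlocks_apply₂₂, W, Xm, D]
      set i' : ℕ := (finSumFinEquiv i : ℕ) with hi'
      have hi'lt : i' < K + K := (finSumFinEquiv i).2
      simp only [finSumFinEquiv_apply_left, finSumFinEquiv_apply_right, Fin.val_castAdd,
        Fin.val_natAdd]
      have hk := k.2
      let f : ℕ → ℂ := fun n => (om n).eval (t i' : ℂ) *
        (if (k : ℕ) ≤ n then ddf t g (n - k) k else 0)
      have hs : (∑ x : Fin K, (om x).eval (t i' : ℂ) *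
          (if (k : ℕ) ≤ x then ddf t g (x - k) k else 0)) +
          ∑ x : Fin K, (om (K + x)).eval (t i' : ℂ) * ddf t g (K + x - k) k =
          ∑ n ∈ Finset.range (K + K), f n := by
        rw [Finset.sum_range_add, ← Fin.sum_univ_eq_sum_range f,
          ← Fin.sum_univ_eq_sum_range (fun x => f (K + x))]
        congr 1
        apply Finset.sum_congr rfl
        intro x _
        simp only [f]
        rw [if_pos (by omega)]
      rw [hs]
      by_cases hik : i' < k
      · rw [hz _ _ hik, zero_mul]
        symm
        apply Finset.sum_eq_zero
        intro n _
        simp only [f]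
        by_cases hn : (k : ℕ) ≤ n
        · rw [hz n i' (by omega), zero_mul]
        · rw [if_neg hn, mul_zero]
      · push Not at hik
        obtain ⟨d, hd'⟩ := Nat.exists_eq_add_of_le hik
        have hN := ddf_newton t g d k (fun a b h1 h2 h3 => (ht a b h2 (by omega)).ne)
        rw [hd', hN, Finset.mul_sum]
        have e1 : K + K = k + (d + 1 + (K + K - k - d - 1)) := by omega
        rw [e1, Finset.sum_range_add f, Finset.sum_range_add (fun x => f (k + x))]
        have z1 : ∑ x ∈ Finset.range (k : ℕ), f x = 0 := by
          apply Finset.sum_eq_zero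
          intro n hn
          simp only [Finset.mem_range] at hn
          simp only [f]
          rw [if_neg (by omega), mul_zero]
        have z2 : ∑ x ∈ Finset.range (K + K - k - d - 1), f (k + (d + 1 + x)) = 0 := by
          apply Finset.sum_eq_zero
          intro n hn
          simp only [f]
          rw [hz _ i' (by omega), zero_mul]
        rw [z1, z2, zero_add, add_zero]
        apply Finset.sum_congr rfl
        intro n _
        simp only [f]
        rw [if_pos (by omega), hev, hev, Finset.prod_range_add, hd', Complex.real_smul]
        simp only [Nat.add_sub_cancel_left]
        push_cast
        ring
  rw [hfac, Matrix.det_mul, hW, Matrix.det_fromBlocks_zero₂₁, Matrix.det_one, one_mul]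
/-! Upper bound for the interpolation determinant -/

lemma fact_ratio (K n k : ℕ) (hk : k ≤ K) :
    K.factorial * K ^ n ≤ (K + n - k).factorial * K ^ k := by
  rcases le_total k n with h | h
  · obtain ⟨d, rfl⟩ := Nat.exists_eq_add_of_le h
    have h1 : K + (k + d) - k = K + d := by omega
    rw [h1, pow_add]
    have h2 := Nat.factorial_mul_pow_le_factorial (m := K) (n := d)
    have h3 : K ^ d ≤ (K + 1) ^ d := Nat.pow_le_pow_left (by omega) d
    calc K.factorial * (K ^ k * K ^ d) = (K.factorial * K ^ d) * K ^ k := by ring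
      _ ≤ (K.factorial * (K + 1) ^ d) * K ^ k := by gcongr
      _ ≤ _ := by gcongr
  · obtain ⟨d, rfl⟩ := Nat.exists_eq_add_of_le h
    have h1 : K + n - (n + d) = K - d := by omega
    rw [h1, pow_add, ← Nat.factorial_mul_descFactorial (n := K) (k := d) (by omega)]
    have := Nat.descFactorial_le_pow K d
    calc (K - d).factorial * K.descFactorial d * K ^ n
        ≤ (K - d).factorial * K ^ d * K ^ n := by gcongr
      _ = _ := by ring

/-- The interpolation determinant with binomial coefficients. -/
noncomputable def matB (K : ℕ) (tn : ℕ → ℕ) (g : ℕ → ℂ) :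
    Matrix (Fin K ⊕ Fin K) (Fin K ⊕ Fin K) ℂ :=
  Matrix.of fun i j => Sum.elim
    (fun k : Fin K => (((tn (finSumFinEquiv i : ℕ)).choose k : ℕ) : ℂ))
    (fun k : Fin K => (((tn (finSumFinEquiv i : ℕ)).choose k : ℕ) : ℂ) *
      g (finSumFinEquiv i : ℕ)) j

open Polynomial in
lemma det_matB (K : ℕ) (tn : ℕ → ℕ) (g : ℕ → ℂ) :
    (matG K (fun i => ((tn i : ℝ) : ℂ)) g (fun k => X ^ k)).det =
      (matB K tn g).det * (∏ k ∈ Finset.range K, (k.factorial : ℂ)) ^ 2 := by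
  rw [← det_matG_monic K _ g (fun k => descPochhammer ℂ k)
    (fun k => descPochhammer_natDegree ℂ k) (fun k => monic_descPochhammer ℂ k)]
  have h : matG K (fun i => ((tn i : ℝ) : ℂ)) g (fun k => descPochhammer ℂ k) =
      matB K tn g * Matrix.diagonal (Sum.elim (fun k : Fin K => ((k : ℕ).factorial : ℂ))
        (fun k : Fin K => ((k : ℕ).factorial : ℂ))) := by
    ext i j
    rw [Matrix.mul_diagonal]
    rcases j with k | k
    · simp [matG, matB, descPochhammer_eval_eq_descFactorial,
        Nat.descFactorial_eq_factorial_mul_choose, mul_comm]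
    · simp [matG, matB, descPochhammer_eval_eq_descFactorial,
        Nat.descFactorial_eq_factorial_mul_choose]
      ring
  rw [h, Matrix.det_mul, Matrix.det_diagonal, Fintype.prod_sum_type]
  simp only [Sum.elim_inl, Sum.elim_inr]
  rw [Fin.prod_univ_eq_prod_range (fun k => (k.factorial : ℂ))]
  ring

lemma upper_bound (K : ℕ) (hK : 0 < K) (tn : ℕ → ℕ) (g e : ℕ → ℂ) (c B : ℝ) (hc : 0 < c)
    (hB : 0 < B)
    (ht : ∀ i j, i < j → j < K + K → tn i < tn j)
    (htB : ∀ i, i < K + K → (tn i : ℝ) ≤ 2 * B)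
    (hg : ∀ i, g i = Complex.exp ((c * (tn i : ℝ) : ℝ) * Complex.I) + e i)
    (he : ∀ n a, a + n < K + K → ‖ddf (fun i => (tn i : ℝ)) e n a‖ ≤ c ^ n / n.factorial) :
    ‖(matB K tn g).det‖ * (∏ k ∈ Finset.range K, (k.factorial : ℝ)) ^ 2 ≤
      ((K + K).factorial * ∏ n ∈ Finset.range (K + K), (2 * (B / 2) ^ n)) *
        (K.factorial * (2 * c ^ K / K.factorial) ^ K) := by
  have htR : ∀ i j, i < j → j < K + K → (tn i : ℝ) < tn j :=
    fun i j h1 h2 => by exact_mod_cast ht i j h1 h2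
  have h1 := det_matG_factor K (fun i => (tn i : ℝ)) g htR
  rw [det_matB] at h1
  have h2 := congrArg norm h1
  rw [norm_mul, norm_mul, norm_pow, norm_prod] at h2
  simp only [Complex.norm_natCast] at h2
  rw [h2, Complex.norm_real, Real.norm_eq_abs]
  have hV := vandermonde_bound (K + K) (fun i => (tn i : ℝ)) B B hB (by
    intro i
    rw [abs_le]
    have := htB i i.2
    have : (0 : ℝ) ≤ tn i := by positivity
    constructor <;> linarith)
  rw [Fin.prod_univ_eq_prod_range (fun n => 2 * (B / 2) ^ n)] at hV
  have hD : ‖(Matrix.of (fun n k : Fin K =>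
      ddf (fun i => (tn i : ℝ)) g (K + n - k) k)).det‖ ≤
        K.factorial * (2 * c ^ K / K.factorial) ^ K := by
    apply det_scaled_bound _ _ (c / K) (by positivity)
    intro n k
    have hn := n.2
    have hk := k.2
    rw [Matrix.of_apply]
    have hgg : g = fun i => Complex.exp ((c * (tn i : ℝ) : ℝ) * Complex.I) + e i := funext hg
    rw [hgg, ddf_add]
    have b1 := ddf_exp_bound (fun i => (tn i : ℝ)) c hc.le (K + n - k) k
      (fun i j h1 h2 h3 => htR i j h2 (by omega))
    have b2 := he (K + n - k) k (by omega)
    refine (norm_add_le _ _).trans ((add_le_add b1 b2).trans ?_)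
    have b3 : ((K.factorial * K ^ (n : ℕ) : ℕ) : ℝ) ≤ ((K + n - k).factorial * K ^ (k : ℕ) : ℕ) :=
      by exact_mod_cast fact_ratio K n k hk.le
    push_cast at b3
    have b4 : c ^ (K + n - k) * c ^ (k : ℕ) = c ^ K * c ^ (n : ℕ) := by
      rw [← pow_add, ← pow_add]; congr 1; omega
    have hKr : (0 : ℝ) < K := by exact_mod_cast hK
    have e1 : c ^ (K + n - k) / (K + n - k).factorial + c ^ (K + n - k) / (K + n - k).factorial
        = 2 * (c ^ K * c ^ (n : ℕ)) / (c ^ (k : ℕ) * (K + n - k).factorial) := by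
      rw [← b4]; field_simp; norm_num
    have e2 : 2 * c ^ K / K.factorial * ((c / K) ^ (n : ℕ) / (c / K) ^ (k : ℕ)) =
        2 * (c ^ K * c ^ (n : ℕ)) * K ^ (k : ℕ) / (c ^ (k : ℕ) * (K.factorial * K ^ (n : ℕ))) := by
      rw [div_pow, div_pow]; field_simp
    rw [e1, e2, div_le_div_iff₀ (by positivity) (by positivity)]
    calc 2 * (c ^ K * c ^ (n : ℕ)) * (c ^ (k : ℕ) * (K.factorial * K ^ (n : ℕ)))
        ≤ 2 * (c ^ K * c ^ (n : ℕ)) * (c ^ (k : ℕ) * ((K + n - k).factorial * K ^ (k : ℕ))) := by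
          gcongr
      _ = _ := by ring
  gcongr

lemma zero_est (K p : ℕ) (hK : 0 < K) (G : ℕ → ℂ) (T2 : Finset ℕ) (hc : 2 * K ≤ T2.card + 1)
    (hG : ∀ t ∈ T2, G t ≠ 0 ∧ G (t + p) = Complex.I * G t)
    (A B : Polynomial ℂ) (hA : A.natDegree < K) (hB : B.natDegree < K)
    (h0 : ∀ t ∈ T2, A.eval (t : ℂ) + B.eval (t : ℂ) * G t = 0)
    (h1 : ∀ t ∈ T2, A.eval ((t + p : ℕ) : ℂ) + B.eval ((t + p : ℕ) : ℂ) * G (t + p) = 0) :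
    A = 0 ∧ B = 0 := by
  have key : ∀ P : Polynomial ℂ, P.natDegree < T2.card → (∀ t ∈ T2, P.eval (t : ℂ) = 0) →
      P = 0 := by
    intro P hP hr
    refine Polynomial.eq_zero_of_natDegree_lt_card_of_eval_eq_zero' P
      (T2.image (fun t : ℕ => (t : ℂ))) ?_ ?_
    · intro z hz
      obtain ⟨t, ht, rfl⟩ := Finset.mem_image.1 hz
      exact hr t ht
    · rw [Finset.card_image_of_injective _ Nat.cast_injective]; exact hP
  set L : Polynomial ℂ := Polynomial.X + Polynomial.C (p : ℂ) with hL
  have hLd : L.natDegree = 1 := Polynomial.natDegree_X_add_C _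
  have hLl : L.leadingCoeff = 1 := Polynomial.leadingCoeff_X_add_C _
  have hz : A * B.comp L * Polynomial.C Complex.I - B * A.comp L = 0 := by
    apply key
    · have e1 : (A * B.comp L * Polynomial.C Complex.I).natDegree ≤ 2 * K - 2 := by
        refine (Polynomial.natDegree_mul_C_le _ _).trans ?_
        refine Polynomial.natDegree_mul_le.trans ?_
        rw [Polynomial.natDegree_comp, hLd]; omega
      have e2 : (B * A.comp L).natDegree ≤ 2 * K - 2 := by
        refine Polynomial.natDegree_mul_le.trans ?_
        rw [Polynomial.natDegree_comp, hLd]; omega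
      have := Polynomial.natDegree_sub_le_of_le e1 e2
      omega
    · intro t ht
      have a0 := h0 t ht
      have a1 := h1 t ht
      rw [(hG t ht).2] at a1
      push_cast at a1
      simp only [Polynomial.eval_sub, Polynomial.eval_mul, Polynomial.eval_comp, hL,
        Polynomial.eval_add, Polynomial.eval_X, Polynomial.eval_C]
      linear_combination (Polynomial.eval ((t : ℂ) + p) B * Complex.I) * a0 -
        (Polynomial.eval (t : ℂ) B) * a1
  have hor : A = 0 ∨ B = 0 := by
    by_contra hne
    push Not at hne
    have e := congrArg Polynomial.leadingCoeff (sub_eq_zero.1 hz)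
    rw [Polynomial.leadingCoeff_mul, Polynomial.leadingCoeff_mul, Polynomial.leadingCoeff_mul,
      Polynomial.leadingCoeff_comp (by omega), Polynomial.leadingCoeff_comp (by omega), hLl,
      Polynomial.leadingCoeff_C] at e
    simp only [one_pow, mul_one] at e
    have hn : A.leadingCoeff * B.leadingCoeff ≠ 0 :=
      mul_ne_zero (Polynomial.leadingCoeff_ne_zero.2 hne.1) (Polynomial.leadingCoeff_ne_zero.2 hne.2)
    have : Complex.I = 1 := by
      apply mul_left_cancel₀ hn
      rw [e]; ring
    have := congrArg Complex.re this
    simp at this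
  rcases hor with h | h
  · refine ⟨h, ?_⟩
    apply key B (by omega)
    intro t ht
    have := h0 t ht
    rw [h] at this
    simpa [(hG t ht).1] using this
  · refine ⟨?_, h⟩
    apply key A (by omega)
    intro t ht
    have := h0 t ht
    rw [h] at this
    simpa [(hG t ht).1] using this

lemma choose_poly (K : ℕ) (hK : 0 < K) (w : Fin K → ℂ) : ∃ A : Polynomial ℂ, A.natDegree < K ∧
    (∀ t : ℕ, A.eval (t : ℂ) = ∑ k : Fin K, ((t.choose k : ℕ) : ℂ) * w k) ∧ (A = 0 → w = 0) := by
  have hev : ∀ t : ℕ, (∑ k : Fin K, Polynomial.C (w k / ((k : ℕ).factorial : ℂ)) *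
      descPochhammer ℂ k).eval (t : ℂ) = ∑ k : Fin K, ((t.choose k : ℕ) : ℂ) * w k := by
    intro t
    rw [Polynomial.eval_finsetSum]
    refine Finset.sum_congr rfl fun k _ => ?_
    rw [Polynomial.eval_mul, Polynomial.eval_C, descPochhammer_eval_eq_descFactorial,
      Nat.descFactorial_eq_factorial_mul_choose]
    have : ((k : ℕ).factorial : ℂ) ≠ 0 := by exact_mod_cast Nat.factorial_ne_zero _
    push_cast
    field_simp
  refine ⟨_, ?_, hev, ?_⟩
  · have : (∑ k : Fin K, Polynomial.C (w k / ((k : ℕ).factorial : ℂ)) *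
      descPochhammer ℂ k).natDegree ≤ K - 1 := by
      refine Polynomial.natDegree_sum_le_of_forall_le _ _ fun k _ => ?_
      refine (Polynomial.natDegree_C_mul_le _ _).trans ?_
      rw [descPochhammer_natDegree]
      omega
    omega
  · intro h0
    have hz : ∀ t : ℕ, ∑ k : Fin K, ((t.choose k : ℕ) : ℂ) * w k = 0 := by
      intro t; rw [← hev, h0]; simp
    have : ∀ n : ℕ, ∀ hn : n < K, w ⟨n, hn⟩ = 0 := by
      intro n
      induction n using Nat.strong_induction_on with
      | _ n ih =>
        intro hn
        have := hz n
        rw [Finset.sum_eq_single ⟨n, hn⟩] at this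
        · simpa using this
        · intro b _ hb
          rcases lt_trichotomy (b : ℕ) n with h | h | h
          · rw [show w b = 0 from ih b h b.2, mul_zero]
          · exact absurd (Fin.ext h) hb
          · rw [Nat.choose_eq_zero_of_lt h]; simp
        · simp
    funext k
    exact this k k.2

lemma row_select {ι : Type} [Fintype ι] [DecidableEq ι] (T : Finset ℕ) (row : ℕ → ι → ℂ)
    (h : ∀ w : ι → ℂ, (∀ t ∈ T, ∑ i, row t i * w i = 0) → w = 0) :
    ∃ tn : ℕ → ℕ, (∀ i j, i < j → j < Fintype.card ι → tn i < tn j) ∧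
      (∀ i < Fintype.card ι, tn i ∈ T) ∧
      LinearIndependent ℂ (fun i : Fin (Fintype.card ι) => row (tn i)) := by
  classical
  have hspan : Submodule.span ℂ (Set.range fun t : T => row t) = ⊤ := by
    by_contra hne
    obtain ⟨f, hf, hle⟩ := Submodule.exists_le_ker_of_lt_top _ (lt_top_iff_ne_top.2 hne)
    apply hf
    have hfe : ∀ x : ι → ℂ, f x = ∑ i, x i * f (Pi.single i 1) := by
      intro x
      conv_lhs => rw [← Finset.univ_sum_single x]
      rw [map_sum]
      refine Finset.sum_congr rfl fun i _ => ?_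
      rw [← smul_eq_mul, ← map_smul]
      congr 1
      ext j
      by_cases hj : j = i
      · subst hj; simp
      · simp [hj]
    have hw := h (fun i => f (Pi.single i 1)) (by
      intro t ht
      rw [← hfe]
      exact hle (Submodule.subset_span ⟨⟨t, ht⟩, rfl⟩))
    ext i
    have := congrFun hw i
    simpa using this
  obtain ⟨κ, a, ha, hs, hl⟩ := exists_linearIndependent' ℂ (fun t : T => row t)
  rw [hspan] at hs
  have : Finite κ := Finite.of_injective a ha
  have := Fintype.ofFinite κ
  have hcard : Fintype.card κ = Fintype.card ι := by
    have b := Module.Basis.mk hl hs.ge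
    rw [← Module.finrank_eq_card_basis b]
    simp
  set T' : Finset ℕ := Finset.univ.image (fun k : κ => (a k : ℕ)) with hT'
  have hinj : Function.Injective (fun k : κ => (a k : ℕ)) :=
    Subtype.val_injective.comp ha
  have hT'c : T'.card = Fintype.card ι := by
    rw [hT', Finset.card_image_of_injective _ hinj, Finset.card_univ, hcard]
  set o := T'.orderEmbOfFin hT'c
  refine ⟨fun i => if hi : i < Fintype.card ι then o ⟨i, hi⟩ else 0, ?_, ?_, ?_⟩
  · intro i j hij hj
    simp only [hj, hij.trans hj, dif_pos]
    exact o.strictMono (by simpa using hij)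
  · intro i hi
    simp only [hi, dif_pos]
    have := Finset.orderEmbOfFin_mem T' hT'c ⟨i, hi⟩
    obtain ⟨k, _, hk⟩ := Finset.mem_image.1 this
    change o ⟨i, hi⟩ ∈ T
    rw [show o ⟨i, hi⟩ = (a k : ℕ) from hk.symm]
    exact (a k).2
  · have hk : ∀ i : Fin (Fintype.card ι), ∃ k : κ, (a k : ℕ) = o i := by
      intro i
      obtain ⟨k, _, hk⟩ := Finset.mem_image.1 (Finset.orderEmbOfFin_mem T' hT'c i)
      exact ⟨k, hk⟩
    choose f hf using hk
    have hfi : Function.Injective f := by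
      intro i j hij
      apply o.injective
      rw [← hf, ← hf, hij]
    have := hl.comp f hfi
    have he : (fun i : Fin (Fintype.card ι) => row (if hi : (i : ℕ) < Fintype.card ι then
        o ⟨i, hi⟩ else 0)) = (((fun t : T => row t) ∘ a) ∘ f) := by
      funext i
      simp [hf]
    rw [he]
    exact this

lemma select_pts (K p : ℕ) (hK : 0 < K) (G : ℕ → ℂ) (T T2 : Finset ℕ)
    (hc : 2 * K ≤ T2.card + 1) (hTT : ∀ t ∈ T2, t ∈ T ∧ t + p ∈ T)
    (hG : ∀ t ∈ T2, G t ≠ 0 ∧ G (t + p) = Complex.I * G t) :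
    ∃ tn : ℕ → ℕ, (∀ i j, i < j → j < K + K → tn i < tn j) ∧ (∀ i < K + K, tn i ∈ T) ∧
      (matB K tn (fun i => G (tn i))).det ≠ 0 := by
  obtain ⟨tn, h1, h2, h3⟩ := row_select (ι := Fin K ⊕ Fin K) T
    (fun t j => Sum.elim (fun k : Fin K => ((t.choose k : ℕ) : ℂ))
      (fun k : Fin K => ((t.choose k : ℕ) : ℂ) * G t) j) (by
    intro w hw
    obtain ⟨A, hA1, hA2, hA3⟩ := choose_poly K hK (fun k => w (Sum.inl k))
    obtain ⟨B, hB1, hB2, hB3⟩ := choose_poly K hK (fun k => w (Sum.inr k))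
    have hv : ∀ t ∈ T, A.eval (t : ℂ) + B.eval (t : ℂ) * G t = 0 := by
      intro t ht
      have := hw t ht
      rw [Fintype.sum_sum_type] at this
      simp only [Sum.elim_inl, Sum.elim_inr] at this
      rw [hA2, hB2, Finset.sum_mul, ← this]
      congr 1
      refine Finset.sum_congr rfl fun k _ => by ring
    obtain ⟨hA, hB⟩ := zero_est K p hK G T2 hc hG A B hA1 hB1 (fun t ht => hv t (hTT t ht).1)
      (fun t ht => hv _ (hTT t ht).2)
    have ha := hA3 hA
    have hb := hB3 hB
    funext j
    rcases j with j | j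
    · exact congrFun ha j
    · exact congrFun hb j)
  simp only [Fintype.card_sum, Fintype.card_fin] at h1 h2 h3
  refine ⟨tn, h1, h2, ?_⟩
  have hu : IsUnit (matB K tn (fun i => G (tn i))) := by
    rw [← Matrix.linearIndependent_rows_iff_isUnit]
    have h4 : Fintype.card (Fin K ⊕ Fin K) = K + K := by simp
    have := h3.comp (fun i : Fin K ⊕ Fin K => (Fin.cast h4.symm (finSumFinEquiv i)))
      (fun i j hij => by simpa using hij)
    have he : (matB K tn fun i => G (tn i)).row = (fun (i : Fin (Fintype.card (Fin K ⊕ Fin K))) j =>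
        Sum.elim (fun k : Fin K => (((tn (i : ℕ)).choose k : ℕ) : ℂ))
        (fun k : Fin K => (((tn (i : ℕ)).choose k : ℕ) : ℂ) * G (tn (i : ℕ))) j) ∘
        (fun i : Fin K ⊕ Fin K => (Fin.cast h4.symm (finSumFinEquiv i))) := by
      funext i j
      rfl
    rw [he]
    exact this
  exact ((Matrix.isUnit_iff_isUnit_det _).1 hu).ne_zero

lemma lower_bound (K : ℕ) (tn : ℕ → ℕ) (g : ℕ → ℂ) (D E : ℕ → GaussianInt)
    (hD : ∀ i, D i ≠ 0)
    (hE : ∀ i < K + K, GaussianInt.toComplex (D i) * g i = GaussianInt.toComplex (E i))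
    (hdet : (matB K tn g).det ≠ 0) :
    1 ≤ (∏ i ∈ Finset.range (K + K), ‖GaussianInt.toComplex (D i)‖) * ‖(matB K tn g).det‖ := by
  classical
  set M : Matrix (Fin K ⊕ Fin K) (Fin K ⊕ Fin K) GaussianInt := Matrix.of fun i j => Sum.elim
    (fun k : Fin K => D (finSumFinEquiv i : ℕ) * (((tn (finSumFinEquiv i : ℕ)).choose k : ℕ) : GaussianInt))
    (fun k : Fin K => (((tn (finSumFinEquiv i : ℕ)).choose k : ℕ) : GaussianInt) *
      E (finSumFinEquiv i : ℕ)) j with hM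
  have h1 : M.map GaussianInt.toComplex =
      Matrix.diagonal (fun i : Fin K ⊕ Fin K => GaussianInt.toComplex (D (finSumFinEquiv i : ℕ))) *
        matB K tn g := by
    ext i j
    rw [Matrix.diagonal_mul]
    rcases j with j | j
    · simp [hM, matB]
    · simp only [hM, matB, Matrix.map_apply, Matrix.of_apply, Sum.elim_inr, map_mul, map_natCast]
      rw [← hE _ (finSumFinEquiv i).2]
      ring
  have h2 : GaussianInt.toComplex M.det =
      (∏ i : Fin K ⊕ Fin K, GaussianInt.toComplex (D (finSumFinEquiv i : ℕ))) *
        (matB K tn g).det := by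
    rw [RingHom.map_det]
    change (M.map GaussianInt.toComplex).det = _
    rw [h1, Matrix.det_mul, Matrix.det_diagonal]
  have h3 : (∏ i : Fin K ⊕ Fin K, ‖GaussianInt.toComplex (D (finSumFinEquiv i : ℕ))‖) =
      ∏ i ∈ Finset.range (K + K), ‖GaussianInt.toComplex (D i)‖ := by
    rw [Finset.prod_range, ← finSumFinEquiv.prod_comp]
  rw [← h3, ← norm_prod, ← norm_mul, ← h2]
  have hne : M.det ≠ 0 := by
    intro h0
    rw [h0, map_zero] at h2
    refine (mul_ne_zero (Finset.prod_ne_zero_iff.2 fun i _ => ?_) hdet) h2.symm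
    rw [Ne, GaussianInt.toComplex_eq_zero]
    exact hD _
  have h4 : 0 < M.det.norm := GaussianInt.norm_pos.2 hne
  have h5 : ((M.det.norm : ℤ) : ℝ) = ‖GaussianInt.toComplex M.det‖ ^ 2 := by
    rw [GaussianInt.intCast_real_norm, Complex.sq_norm]
  have h6 : (1 : ℝ) ≤ (M.det.norm : ℤ) := by exact_mod_cast h4
  rw [h5] at h6
  nlinarith [norm_nonneg (GaussianInt.toComplex M.det)]

def ptOK (p : ℕ) (k : ℤ) (ρ : ℕ) (t : ℕ) (r : ℤ) : Prop := |r| ≤ ρ ∧ (p : ℤ) ∣ t - r * k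

open Classical in
noncomputable def rfun (p : ℕ) (k : ℤ) (ρ : ℕ) (t : ℕ) : ℤ :=
  if h : ∃ r, ptOK p k ρ t r then h.choose else 0

lemma rfun_spec {p : ℕ} {k : ℤ} {ρ t : ℕ} (h : ∃ r, ptOK p k ρ t r) :
    ptOK p k ρ t (rfun p k ρ t) := by
  unfold rfun
  rw [dif_pos h]
  exact h.choose_spec

lemma rfun_abs (p : ℕ) (k : ℤ) (ρ t : ℕ) : |rfun p k ρ t| ≤ ρ := by
  by_cases h : ∃ r, ptOK p k ρ t r
  · exact (rfun_spec h).1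
  · unfold rfun
    rw [dif_neg h]
    simp

lemma ptOK_unique {p : ℕ} (hp : p.Prime) {k : ℤ} (hk : ¬ (p : ℤ) ∣ k) {ρ : ℕ} (hρ : 2 * ρ < p)
    {t t' : ℕ} {r r' : ℤ} (h : ptOK p k ρ t r) (h' : ptOK p k ρ t' r')
    (htt : (p : ℤ) ∣ (t : ℤ) - t') : r = r' := by
  have h1 : (p : ℤ) ∣ (r' - r) * k := by
    have := (dvd_sub h.2 h'.2)
    have := dvd_sub this htt
    refine this.trans (dvd_of_eq ?_)
    ring
  rcases (Nat.prime_iff_prime_int.1 hp).dvd_or_dvd h1 with h2 | h2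
  · have h3 := Int.eq_zero_of_abs_lt_dvd h2 (by
      have a1 := abs_le.1 h.1
      have a2 := abs_le.1 h'.1
      rw [abs_lt]
      constructor <;> omega)
    omega
  · exact absurd h2 hk

lemma rfun_eq {p : ℕ} (hp : p.Prime) {k : ℤ} (hk : ¬ (p : ℤ) ∣ k) {ρ : ℕ} (hρ : 2 * ρ < p)
    {t : ℕ} {r : ℤ} (h : ptOK p k ρ t r) : rfun p k ρ t = r :=
  ptOK_unique hp hk hρ (rfun_spec ⟨r, h⟩) h (by simp)

open Classical in
noncomputable def Tset (p : ℕ) (k : ℤ) (ρ n : ℕ) : Finset ℕ :=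
  (Finset.range (n * p)).filter fun t => ∃ r, ptOK p k ρ t r

lemma mem_Tset {p : ℕ} {k : ℤ} {ρ n t : ℕ} : t ∈ Tset p k ρ n ↔
    t < n * p ∧ ∃ r, ptOK p k ρ t r := by
  unfold Tset
  simp

lemma Tset_shift {p : ℕ} {k : ℤ} {ρ n t : ℕ} (h : t ∈ Tset p k ρ n) :
    t ∈ Tset p k ρ (n + 1) ∧ t + p ∈ Tset p k ρ (n + 1) := by
  rw [mem_Tset] at *
  obtain ⟨h1, r, h2, h3⟩ := h
  rw [mem_Tset]
  refine ⟨⟨by nlinarith, r, h2, h3⟩, by nlinarith, r, h2, ?_⟩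
  have := dvd_add h3 (dvd_refl (p : ℤ))
  refine this.trans (dvd_of_eq ?_)
  push_cast
  ring

lemma Tset_card {p : ℕ} (hp : p.Prime) {k : ℤ} (hk : ¬ (p : ℤ) ∣ k) {ρ : ℕ} (hρ : 2 * ρ < p)
    (n : ℕ) : n * (2 * ρ + 1) ≤ (Tset p k ρ n).card := by
  have hp0 : (0 : ℤ) < p := by exact_mod_cast hp.pos
  have hcard : ((Finset.Icc (-(ρ : ℤ)) ρ) ×ˢ Finset.range n).card = n * (2 * ρ + 1) := by
    rw [Finset.card_product, Int.card_Icc, Finset.card_range, mul_comm]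
    congr 1
    omega
  rw [← hcard]
  have hval : ∀ r : ℤ, (((r * k % p).toNat : ℕ) : ℤ) = r * k % p := fun r =>
    Int.toNat_of_nonneg (Int.emod_nonneg _ hp0.ne')
  have hlt : ∀ r : ℤ, (r * k % p).toNat < p := by
    intro r
    have := Int.emod_lt_of_pos (r * k) hp0
    have := hval r
    omega
  have hok : ∀ x ∈ ((Finset.Icc (-(ρ : ℤ)) ρ) ×ˢ Finset.range n),
      ptOK p k ρ ((x.1 * k % p).toNat + x.2 * p) x.1 := by
    rintro ⟨r, j⟩ hx
    simp only [Finset.mem_product, Finset.mem_Icc, Finset.mem_range] at hx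
    refine ⟨abs_le.2 hx.1, ?_⟩
    push_cast
    rw [hval]
    have : (p : ℤ) ∣ r * k % p - r * k := by
      have := Int.emod_add_mul_ediv (r * k) p
      exact ⟨-(r * k / p), by linarith⟩
    have := dvd_add this (dvd_mul_left (p : ℤ) j)
    refine this.trans (dvd_of_eq ?_)
    ring
  refine Finset.card_le_card_of_injOn (fun x : ℤ × ℕ => (x.1 * k % p).toNat + x.2 * p) ?_ ?_
  · intro x hx
    have h2 := hok x hx
    have hx' := hx
    rw [Finset.mem_coe, Finset.mem_product, Finset.mem_range] at hx'
    rw [Finset.mem_coe, mem_Tset]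
    refine ⟨?_, _, h2⟩
    have := hlt x.1
    change (x.1 * k % p).toNat + x.2 * p < n * p
    have : (x.2 + 1) * p ≤ n * p := Nat.mul_le_mul_right _ hx'.2
    nlinarith
  · intro x hx x' hx' he
    have h1 : x.1 = x'.1 := ptOK_unique hp hk hρ (hok x hx) (hok x' hx') (by
      have he' : (x.1 * k % p).toNat + x.2 * p = (x'.1 * k % p).toNat + x'.2 * p := he
      rw [he']
      simp)
    have he' : (x.1 * k % p).toNat + x.2 * p = (x'.1 * k % p).toNat + x'.2 * p := he
    rw [h1] at he'
    have : x.2 = x'.2 := Nat.eq_of_mul_eq_mul_right hp.pos (by omega)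
    exact Prod.ext h1 this

lemma window_inj {p : ℕ} (hp : p.Prime) {k : ℤ} {ρ : ℕ} (x : ℕ) {t t' : ℕ} (hx : x ≤ t) (hx' : x ≤ t')
    (h : ∃ r, ptOK p k ρ t r) (h' : ∃ r, ptOK p k ρ t' r)
    (hr : rfun p k ρ t = rfun p k ρ t') (hd : (t - x) / p = (t' - x) / p) : t = t' := by
  have h1 := (rfun_spec h).2
  have h2 := (rfun_spec h').2
  rw [← hr] at h2
  have h3 : (p : ℤ) ∣ ((t - x : ℕ) : ℤ) - ((t' - x : ℕ) : ℤ) := by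
    have := dvd_sub h1 h2
    refine this.trans (dvd_of_eq ?_)
    push_cast [hx, hx']
    ring
  have h4 : (t - x) % p = (t' - x) % p := by
    have h5 : ((t' - x : ℕ) : ℤ) ≡ ((t - x : ℕ) : ℤ) [ZMOD p] := (Int.modEq_iff_dvd).2 h3
    exact ((Int.natCast_modEq_iff).1 h5).symm
  have a1 := Nat.div_add_mod (t - x) p
  have a2 := Nat.div_add_mod (t' - x) p
  rw [hd, h4] at a1
  omega

lemma window_card {p : ℕ} (hp : p.Prime) {k : ℤ} {ρ : ℕ} (x n : ℕ) (W : Finset ℕ)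
    (hW : ∀ t ∈ W, x ≤ t ∧ t < x + n * p ∧ ∃ r, ptOK p k ρ t r) : W.card ≤ n * (2 * ρ + 1) := by
  have hcard : ((Finset.Icc (-(ρ : ℤ)) ρ) ×ˢ Finset.range n).card = n * (2 * ρ + 1) := by
    rw [Finset.card_product, Int.card_Icc, Finset.card_range, mul_comm]
    congr 1
    omega
  rw [← hcard]
  refine Finset.card_le_card_of_injOn (fun t => (rfun p k ρ t, (t - x) / p)) ?_ ?_
  · intro t ht
    have h := hW t ht
    rw [Finset.mem_coe, Finset.mem_product, Finset.mem_Icc, Finset.mem_range]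
    refine ⟨abs_le.1 (rfun_abs p k ρ t), ?_⟩
    change (t - x) / p < n
    rw [Nat.div_lt_iff_lt_mul hp.pos]
    omega
  · intro t ht t' ht' he
    have h := hW t ht
    have h' := hW t' ht'
    rw [Prod.mk.injEq] at he
    exact window_inj hp x h.1 h'.1 h.2.2 h'.2.2 he.1 he.2

lemma sum_abs_Icc (ρ : ℕ) : ∑ r ∈ Finset.Icc (-(ρ : ℤ)) ρ, r.natAbs = ρ * (ρ + 1) := by
  induction ρ with
  | zero => simp
  | succ n ih =>
    have : Finset.Icc (-((n + 1 : ℕ) : ℤ)) ((n + 1 : ℕ) : ℤ) =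
        insert (-((n + 1 : ℕ) : ℤ)) (insert ((n + 1 : ℕ) : ℤ) (Finset.Icc (-(n : ℤ)) n)) := by
      ext a
      simp only [Finset.mem_Icc, Finset.mem_insert]
      omega
    rw [this, Finset.sum_insert, Finset.sum_insert, ih]
    · simp only [Int.natAbs_neg, Int.natAbs_natCast]
      ring
    · simp only [Finset.mem_Icc]; omega
    · simp only [Finset.mem_Icc, Finset.mem_insert]; omega

lemma sum_rfun {p : ℕ} (hp : p.Prime) {k : ℤ} {ρ : ℕ} (n : ℕ) (W : Finset ℕ)
    (hW : W ⊆ Tset p k ρ n) : ∑ t ∈ W, (rfun p k ρ t).natAbs ≤ n * (ρ * (ρ + 1)) := by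
  classical
  have hinj : Set.InjOn (fun t => (rfun p k ρ t, t / p)) (W : Set ℕ) := by
    intro t ht t' ht' he
    have h := mem_Tset.1 (hW ht)
    have h' := mem_Tset.1 (hW ht')
    rw [Prod.mk.injEq] at he
    exact window_inj hp 0 (Nat.zero_le _) (Nat.zero_le _) h.2 h'.2 he.1 (by simpa using he.2)
  have h1 : ∑ t ∈ W, (rfun p k ρ t).natAbs =
      ∑ z ∈ W.image (fun t => (rfun p k ρ t, t / p)), z.1.natAbs := by
    rw [Finset.sum_image hinj]
  rw [h1]
  have hsub : W.image (fun t => (rfun p k ρ t, t / p)) ⊆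
      (Finset.Icc (-(ρ : ℤ)) ρ) ×ˢ Finset.range n := by
    intro z hz
    obtain ⟨t, ht, rfl⟩ := Finset.mem_image.1 hz
    have h := mem_Tset.1 (hW ht)
    rw [Finset.mem_product, Finset.mem_Icc, Finset.mem_range]
    refine ⟨abs_le.1 (rfun_abs p k ρ t), ?_⟩
    change t / p < n
    rw [Nat.div_lt_iff_lt_mul hp.pos]
    exact h.1
  refine (Finset.sum_le_sum_of_subset hsub).trans ?_
  rw [Finset.sum_product]
  simp only [Finset.sum_const, Finset.card_range, smul_eq_mul]
  rw [← Finset.mul_sum, sum_abs_Icc]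

lemma sep_pts {p : ℕ} (hp : p.Prime) {k : ℤ} {ρ : ℕ} (N n : ℕ) (tn : ℕ → ℕ)
    (hmono : ∀ i j, i < j → j < N → tn i < tn j) (hT : ∀ i < N, tn i ∈ Tset p k ρ n)
    (a d : ℕ) (hN : a + d < N) : tn a + p * (d / (2 * ρ + 1)) ≤ tn (a + d) := by
  classical
  by_contra hlt
  push Not at hlt
  have hmono' : ∀ i j, i ≤ j → j < N → tn i ≤ tn j := by
    intro i j hij hj
    rcases hij.lt_or_eq with h | h
    · exact (hmono i j h hj).le
    · rw [h]
  have h1 := window_card hp (k := k) (ρ := ρ) (tn a) (d / (2 * ρ + 1))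
    ((Finset.Icc a (a + d)).image tn) (by
      intro t ht
      obtain ⟨i, hi, rfl⟩ := Finset.mem_image.1 ht
      rw [Finset.mem_Icc] at hi
      refine ⟨hmono' _ _ hi.1 (by omega), ?_, (mem_Tset.1 (hT i (by omega))).2⟩
      have := hmono' _ _ hi.2 hN
      rw [mul_comm]
      omega)
  rw [Finset.card_image_of_injOn, Nat.card_Icc] at h1
  · have := Nat.div_mul_le_self d (2 * ρ + 1)
    omega
  · intro i hi j hj hij
    simp only [Finset.coe_Icc, Set.mem_Icc] at hi hj
    rcases lt_trichotomy i j with h | h | h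
    · have := hmono i j h (by omega); omega
    · exact h
    · have := hmono j i h (by omega); omega

lemma I_zpow_gauss (s : ℤ) : ∃ w : GaussianInt, GaussianInt.toComplex w = Complex.I ^ s := by
  refine ⟨(⟨0, 1⟩ : GaussianInt) ^ (s % 4).toNat, ?_⟩
  have h1 : GaussianInt.toComplex (⟨0, 1⟩ : GaussianInt) = Complex.I := by
    simp [GaussianInt.toComplex_def']
  rw [map_pow, h1, ← zpow_natCast, Int.toNat_of_nonneg (Int.emod_nonneg _ (by norm_num))]
  conv_rhs => rw [← Int.emod_add_mul_ediv s 4]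
  rw [zpow_add₀ Complex.I_ne_zero, zpow_mul]
  have : Complex.I ^ (4 : ℤ) = 1 := by
    rw [show (4 : ℤ) = ((4 : ℕ) : ℤ) from rfl, zpow_natCast, Complex.I_pow_four]
  rw [this]
  simp

lemma clear_denom (α : GaussianInt) (hα : α ≠ 0) (γ : ℂ)
    (hγ : GaussianInt.toComplex α = GaussianInt.toComplex (star α) * γ) (r s : ℤ) :
    ∃ D E : GaussianInt, D ≠ 0 ∧ ‖GaussianInt.toComplex D‖ = ‖GaussianInt.toComplex α‖ ^ r.natAbs ∧
      GaussianInt.toComplex D * (γ ^ r * Complex.I ^ s) = GaussianInt.toComplex E := by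
  obtain ⟨w, hw⟩ := I_zpow_gauss s
  have hα' : star α ≠ 0 := by simpa using hα
  have hn : ‖GaussianInt.toComplex (star α)‖ = ‖GaussianInt.toComplex α‖ := by
    rw [GaussianInt.toComplex_star, RCLike.norm_conj]
  have hz : GaussianInt.toComplex α ≠ 0 := by rwa [Ne, GaussianInt.toComplex_eq_zero]
  have hγ0 : γ ≠ 0 := by
    rintro rfl
    simp at hγ
    exact hα hγ
  rcases Int.natAbs_eq r with h | h
  · refine ⟨star α ^ r.natAbs, α ^ r.natAbs * w, pow_ne_zero _ hα', ?_, ?_⟩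
    · rw [map_pow, norm_pow, hn]
    · rw [h, zpow_natCast, ← hw, Int.natAbs_natCast, map_mul, map_pow, map_pow, hγ]
      ring
  · refine ⟨α ^ r.natAbs, star α ^ r.natAbs * w, pow_ne_zero _ hα, ?_, ?_⟩
    · rw [map_pow, norm_pow]
    · rw [h, zpow_neg, zpow_natCast, ← hw, Int.natAbs_neg, Int.natAbs_natCast, map_mul, map_pow,
        map_pow, hγ, mul_pow]
      have : γ ^ r.natAbs ≠ 0 := pow_ne_zero _ hγ0
      field_simp

noncomputable def Hfn (R : ℕ) (h : ℝ) (d : ℕ) : ℝ := if d < R then (d : ℝ) else d * h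

lemma Hfn_prod (R : ℕ) (h : ℝ) (hh : 1 ≤ h) (n : ℕ) :
    (n.factorial : ℝ) * h ^ n ≤ (∏ d ∈ Finset.range n, Hfn R h (d + 1)) * h ^ (min n R) := by
  have h0 : 0 ≤ h := by linarith
  have hpos : ∀ d, 0 ≤ Hfn R h d := by
    intro d
    unfold Hfn
    split_ifs <;> positivity
  induction n with
  | zero => simp
  | succ n ih =>
    rw [Nat.factorial_succ, Finset.prod_range_succ, pow_succ]
    have hP : 0 ≤ ∏ d ∈ Finset.range n, Hfn R h (d + 1) := Finset.prod_nonneg fun d _ => hpos _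
    push_cast
    have e : ((n : ℝ) + 1) * n.factorial * (h ^ n * h) = (n.factorial * h ^ n) * ((n + 1) * h) := by
      ring
    rw [e]
    refine (mul_le_mul_of_nonneg_right ih (by positivity)).trans ?_
    by_cases hn : n + 1 < R
    · rw [Hfn, if_pos hn, min_eq_left (by omega), min_eq_left (by omega), pow_succ]
      push_cast
      apply le_of_eq
      ring
    · rw [Hfn, if_neg hn]
      have : h ^ (min n R) ≤ h ^ (min (n + 1) R) := pow_le_pow_right₀ hh (by omega)
      push_cast
      calc _ = (∏ d ∈ Finset.range n, Hfn R h (d + 1)) * ((n + 1) * h) * h ^ (min n R) := by ring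
        _ ≤ _ := mul_le_mul_of_nonneg_left this (by positivity)

lemma exp_diff (x y : ℝ) :
    ‖Complex.exp (((x + y : ℝ) : ℂ) * Complex.I) - Complex.exp ((x : ℂ) * Complex.I)‖ ≤ |y| := by
  have : Complex.exp (((x + y : ℝ) : ℂ) * Complex.I) - Complex.exp ((x : ℂ) * Complex.I) =
      Complex.exp ((x : ℂ) * Complex.I) * (Complex.exp (Complex.I * (y : ℂ)) - 1) := by
    rw [mul_sub, ← Complex.exp_add]
    push_cast
    ring_nf
  rw [this, norm_mul, Complex.norm_exp_ofReal_mul_I, one_mul]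
  have := Real.norm_exp_I_mul_ofReal_sub_one_le (x := y)
  simpa using this

lemma core (p ρ S K : ℕ) (hp : p.Prime) (k : ℤ) (hk : ¬ (p : ℤ) ∣ k) (hρ : 2 * (2 * ρ + 1) ≤ p)
    (hK : 0 < K) (hKS : K + K = S * (2 * ρ + 1)) (α : GaussianInt) (hα : α ≠ 0) (φ η : ℝ)
    (hφ : GaussianInt.toComplex α =
      GaussianInt.toComplex (star α) * Complex.exp ((φ : ℂ) * Complex.I))
    (hη : p * φ = k * (Real.pi / 2) + η)
    (hsm : |η| * ((p : ℝ) / (2 * (2 * ρ + 1 : ℕ))) ^ (2 * ρ + 1) *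
      (3 * (2 * ρ + 1 : ℕ) : ℝ) ^ (K + K) ≤ 1) :
    (∏ k ∈ Finset.range K, (k.factorial : ℝ)) ^ 2 ≤
      ‖GaussianInt.toComplex α‖ ^ ((S + 1) * (ρ * (ρ + 1))) *
      ((((K + K).factorial : ℝ) * ∏ n ∈ Finset.range (K + K), (2 * (((S + 1) * p / 2 : ℝ) / 2) ^ n)) *
        ((K.factorial : ℝ) * (2 * (Real.pi / (2 * p)) ^ K / K.factorial) ^ K)) := by
  classical
  have hp0 : (0 : ℝ) < p := by exact_mod_cast hp.pos
  have hpc : (p : ℂ) ≠ 0 := by exact_mod_cast hp.ne_zero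
  have hpi := Real.pi_pos
  set R : ℕ := 2 * ρ + 1 with hR
  have hR0 : (0 : ℝ) < R := by rw [hR]; positivity
  set h : ℝ := (p : ℝ) / (2 * R) with hh
  have hh1 : 1 ≤ h := by
    rw [hh, le_div_iff₀ (by positivity), one_mul]
    exact_mod_cast hρ
  set γ : ℂ := Complex.exp ((φ : ℂ) * Complex.I) with hγ
  set rf := rfun p k ρ with hrf
  set G : ℕ → ℂ := fun t => γ ^ (rf t) * Complex.I ^ (((t : ℤ) - rf t * k) / p) with hG
  have hγ0 : γ ≠ 0 := Complex.exp_ne_zero _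
  have hG0 : ∀ t, G t ≠ 0 := fun t => mul_ne_zero (zpow_ne_zero _ hγ0) (zpow_ne_zero _ Complex.I_ne_zero)
  obtain ⟨tn, hmono, hT, hdet⟩ := select_pts K p hK G (Tset p k ρ (S + 1)) (Tset p k ρ S)
    (by
      have := Tset_card hp hk (ρ := ρ) (by omega) S
      rw [← hR, ← hKS] at this
      omega)
    (fun t ht => Tset_shift ht) (by
      intro t ht
      refine ⟨hG0 t, ?_⟩
      have h1 := rfun_spec (mem_Tset.1 ht).2
      have h2 := rfun_spec (mem_Tset.1 (Tset_shift ht).2).2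
      have h3 : rf (t + p) = rf t := ptOK_unique hp hk (by omega) h2 h1 (by simp)
      have h4 : (((t + p : ℕ) : ℤ) - rf t * k) / p = ((t : ℤ) - rf t * k) / p + 1 := by
        rw [show ((t + p : ℕ) : ℤ) - rf t * k = ((t : ℤ) - rf t * k) + p by push_cast; ring]
        rw [Int.add_ediv_of_dvd_right (dvd_refl _), Int.ediv_self (by exact_mod_cast hp.ne_zero)]
      simp only [hG, h3, h4]
      rw [zpow_add₀ Complex.I_ne_zero, zpow_one]
      ring)
  set c : ℝ := Real.pi / (2 * p) with hc
  have hc0 : 0 < c := by positivity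
  set e : ℕ → ℂ := fun i => G (tn i) - Complex.exp ((c * (tn i : ℝ) : ℝ) * Complex.I) with he
  -- error bound
  have hebd : ∀ i < K + K, ‖e i‖ ≤ |η| := by
    intro i hi
    have h1 := rfun_spec (mem_Tset.1 (hT i hi)).2
    obtain ⟨s, hs⟩ := h1.2
    have hsd : ((tn i : ℤ) - rf (tn i) * k) / p = s := by
      rw [hs, Int.mul_ediv_cancel_left _ (by exact_mod_cast hp.ne_zero)]
    have hsR : (tn i : ℝ) - rf (tn i) * k = p * s := by exact_mod_cast hs
    have hGe : G (tn i) = Complex.exp (((c * (tn i : ℝ) + rf (tn i) * η / p : ℝ) : ℂ) * Complex.I) := by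
      simp only [hG]
      rw [hsd, hγ, ← Complex.exp_int_mul]
      have hI : Complex.I = Complex.exp (((Real.pi / 2 : ℝ) : ℂ) * Complex.I) := by
        push_cast
        rw [Complex.exp_pi_div_two_mul_I]
      have hIs : Complex.I ^ s = Complex.exp ((s : ℂ) * (((Real.pi / 2 : ℝ) : ℂ) * Complex.I)) := by
        rw [Complex.exp_int_mul, ← hI]
      rw [hIs, ← Complex.exp_add]
      congr 1
      have : c * (tn i : ℝ) + rf (tn i) * η / p = rf (tn i) * φ + s * (Real.pi / 2) := by
        rw [hc]
        field_simp
        linear_combination (Real.pi) * hsR - 2 * (rf (tn i) : ℝ) * hη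
      rw [this]
      push_cast
      ring
    simp only [he]
    rw [hGe]
    refine (exp_diff _ _).trans ?_
    have h2 : |(rf (tn i) : ℝ)| ≤ ρ := by exact_mod_cast h1.1
    have h3 : (ρ : ℝ) ≤ p := by
      have : ρ ≤ p := by omega
      exact_mod_cast this
    rw [abs_div, abs_mul, abs_of_pos hp0, div_le_iff₀ hp0, mul_comm]
    exact mul_le_mul_of_nonneg_left (h2.trans h3) (abs_nonneg _)
  have hup := upper_bound K hK tn (fun i => G (tn i)) e c ((S + 1) * p / 2 : ℝ) hc0 (by positivity)
    hmono (by
      intro i hi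
      have := (mem_Tset.1 (hT i hi)).1
      have h2 : (tn i : ℝ) ≤ (((S + 1) * p : ℕ) : ℝ) := by exact_mod_cast this.le
      push_cast at h2
      linarith) (fun i => by simp [he]) (by
      intro n a han
      have hb := ddf_bound_sep (fun i => (tn i : ℝ)) e (K + K) |η| (abs_nonneg _) (Hfn R h)
        (by
          intro d hd
          unfold Hfn
          have : (0 : ℝ) < d := by exact_mod_cast hd
          split_ifs <;> positivity) hebd (by
          intro a d hd had
          unfold Hfn
          split_ifs with hdR
          · have : ∀ d, a + d < K + K → tn a + d ≤ tn (a + d) := by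
              intro d
              induction d with
              | zero => simp
              | succ m ih =>
                intro hm
                have h1 := ih (by omega)
                have h2 := hmono (a + m) (a + (m + 1)) (by omega) hm
                omega
            have h3 := this d had
            have h4 : (tn a : ℝ) + d ≤ tn (a + d) := by exact_mod_cast h3
            linarith
          · have h3 := sep_pts hp (K + K) (S + 1) tn hmono hT a d had
            have h4 : (tn a : ℝ) + p * ((d / R : ℕ) : ℝ) ≤ tn (a + d) := by exact_mod_cast h3
            have h5 : d ≤ 2 * R * (d / R) := by
              have h6 := Nat.div_add_mod d R
              have h7 := Nat.mod_lt d (show 0 < R by omega)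
              have h8 : 1 ≤ d / R := (Nat.one_le_div_iff (by omega)).2 (by omega)
              nlinarith
            have h5' : (d : ℝ) ≤ 2 * R * ((d / R : ℕ) : ℝ) := by exact_mod_cast h5
            have h6 : (d : ℝ) * h ≤ p * ((d / R : ℕ) : ℝ) := by
              rw [hh, mul_div_assoc', div_le_iff₀ (by positivity)]
              nlinarith
            linarith) n a han
      refine hb.trans ?_
      have hf0 : (0 : ℝ) < n.factorial := by exact_mod_cast n.factorial_pos
      have hH := Hfn_prod R h hh1 n
      set P := ∏ d ∈ Finset.range n, Hfn R h (d + 1) with hP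
      have hP0 : 0 < P := Finset.prod_pos fun d _ => by
        unfold Hfn
        have : (0 : ℝ) < ((d + 1 : ℕ) : ℝ) := by positivity
        split_ifs <;> positivity
      rw [div_le_div_iff₀ hP0 hf0]
      have hh0 : 0 < h := by linarith
      have k1 : (n.factorial : ℝ) * h ^ n ≤ P * h ^ R :=
        hH.trans (mul_le_mul_of_nonneg_left (pow_le_pow_right₀ hh1 (min_le_right _ _)) hP0.le)
      have k2 : |η| * h ^ R * (3 * R : ℝ) ^ n ≤ 1 := by
        refine le_trans ?_ hsm
        refine mul_le_mul_of_nonneg_left (pow_le_pow_right₀ ?_ (by omega)) (by positivity)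
        have : (1 : ℝ) ≤ R := by rw [hR]; push_cast; linarith [(Nat.cast_nonneg ρ : (0 : ℝ) ≤ ρ)]
        linarith
      have k3 : (2 : ℝ) ^ n ≤ (3 * R : ℝ) ^ n * (c ^ n * h ^ n) := by
        rw [← mul_pow, ← mul_pow]
        refine pow_le_pow_left₀ (by norm_num) ?_ n
        have : 3 * (R : ℝ) * (c * h) = 3 * Real.pi / 4 := by
          rw [hc, hh]
          field_simp
          norm_num
        rw [this]
        linarith [Real.pi_gt_three]
      have hhR : 0 < h ^ R := by positivity
      have : |η| * 2 ^ n * n.factorial * h ^ R ≤ c ^ n * P * h ^ R := by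
        calc |η| * 2 ^ n * n.factorial * h ^ R
            ≤ |η| * ((3 * R : ℝ) ^ n * (c ^ n * h ^ n)) * n.factorial * h ^ R := by gcongr
          _ = (|η| * h ^ R * (3 * R : ℝ) ^ n) * (c ^ n * (n.factorial * h ^ n)) := by ring
          _ ≤ 1 * (c ^ n * (n.factorial * h ^ n)) :=
              mul_le_mul_of_nonneg_right k2 (by positivity)
          _ ≤ 1 * (c ^ n * (P * h ^ R)) := by gcongr
          _ = _ := by ring
      exact le_of_mul_le_mul_right this hhR)
  -- lower bound
  have hch : ∀ i, ∃ D E : GaussianInt, D ≠ 0 ∧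
      ‖GaussianInt.toComplex D‖ = ‖GaussianInt.toComplex α‖ ^ (rf (tn i)).natAbs ∧
      GaussianInt.toComplex D * G (tn i) = GaussianInt.toComplex E :=
    fun i => clear_denom α hα γ hφ _ _
  choose D E hD hDn hDE using hch
  have hlow := lower_bound K tn (fun i => G (tn i)) D E hD (fun i _ => hDE i) hdet
  have hprod : ∏ i ∈ Finset.range (K + K), ‖GaussianInt.toComplex (D i)‖ ≤
      ‖GaussianInt.toComplex α‖ ^ ((S + 1) * (ρ * (ρ + 1))) := by
    rw [Finset.prod_congr rfl (fun i _ => hDn i), Finset.prod_pow_eq_pow_sum]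
    apply pow_le_pow_right₀
    · have h4 : 0 < α.norm := GaussianInt.norm_pos.2 hα
      have h5 : ((α.norm : ℤ) : ℝ) = ‖GaussianInt.toComplex α‖ ^ 2 := by
        rw [GaussianInt.intCast_real_norm, Complex.sq_norm]
      have h6 : (1 : ℝ) ≤ (α.norm : ℤ) := by exact_mod_cast h4
      rw [h5] at h6
      nlinarith [norm_nonneg (GaussianInt.toComplex α)]
    · have hinj : Set.InjOn tn (Finset.range (K + K) : Set ℕ) := by
        intro i hi j hj hij
        simp only [Finset.coe_range, Set.mem_Iio] at hi hj
        rcases lt_trichotomy i j with h | h | h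
        · have := hmono i j h hj; omega
        · exact h
        · have := hmono j i h hi; omega
      have := sum_rfun hp (S + 1) ((Finset.range (K + K)).image tn) (k := k) (ρ := ρ) (by
        intro t ht
        obtain ⟨i, hi, rfl⟩ := Finset.mem_image.1 ht
        exact hT i (Finset.mem_range.1 hi))
      rwa [Finset.sum_image hinj] at this
  have hsf : 0 ≤ (∏ k ∈ Finset.range K, (k.factorial : ℝ)) ^ 2 := by positivity
  calc (∏ k ∈ Finset.range K, (k.factorial : ℝ)) ^ 2
      ≤ ((∏ i ∈ Finset.range (K + K), ‖GaussianInt.toComplex (D i)‖) *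
        ‖(matB K tn (fun i => G (tn i))).det‖) * (∏ k ∈ Finset.range K, (k.factorial : ℝ)) ^ 2 :=
        le_mul_of_one_le_left hsf hlow
    _ = (∏ i ∈ Finset.range (K + K), ‖GaussianInt.toComplex (D i)‖) *
        (‖(matB K tn (fun i => G (tn i))).det‖ * (∏ k ∈ Finset.range K, (k.factorial : ℝ)) ^ 2) := by
        ring
    _ ≤ _ := mul_le_mul hprod hup (by positivity) (by positivity)

lemma log_le_lin (x : ℝ) (hx : 0 < x) : Real.log x ≤ 5 + x / 403 := by
  have h1 := Real.add_one_le_exp (Real.log x - 6)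
  rw [Real.exp_sub, Real.exp_log hx] at h1
  have h2 : (403 : ℝ) ≤ Real.exp 6 := by
    have h3 : Real.exp 6 = Real.exp 1 ^ 6 := by rw [← Real.exp_nat_mul]; norm_num
    rw [h3]
    calc (403 : ℝ) ≤ 2.7182818283 ^ 6 := by norm_num
      _ ≤ _ := pow_le_pow_left₀ (by norm_num) Real.exp_one_gt_d9.le 6
  have h4 : x / Real.exp 6 ≤ x / 403 := by gcongr
  linarith

lemma log_fact_ge (K : ℕ) (hK : 0 < K) :
    (K : ℝ) * Real.log K - K ≤ Real.log K.factorial := by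
  have hK' : (0 : ℝ) < K := by exact_mod_cast hK
  have hf : (0 : ℝ) < K.factorial := by exact_mod_cast K.factorial_pos
  have h := Real.pow_div_factorial_le_exp (K : ℝ) hK'.le K
  have h2 := Real.log_le_log (by positivity) h
  rw [Real.log_exp, Real.log_div (by positivity) (by positivity), Real.log_pow] at h2
  linarith

lemma log_fact_le (K : ℕ) : Real.log K.factorial ≤ (K : ℝ) * Real.log K := by
  have hf : (0 : ℝ) < K.factorial := by exact_mod_cast K.factorial_pos
  rw [← Real.log_pow]
  apply Real.log_le_log hf
  exact_mod_cast Nat.factorial_le_pow K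

lemma log_sf_ge (K : ℕ) (hK : 1 ≤ K) :
    (K : ℝ) ^ 2 / 2 * Real.log K - 3 * (K : ℝ) ^ 2 / 4 - K * Real.log K ≤
      Real.log (∏ k ∈ Finset.range K, (k.factorial : ℝ)) := by
  induction K, hK using Nat.le_induction with
  | base => norm_num
  | succ K hK ih =>
    have hK' : (1 : ℝ) ≤ K := by exact_mod_cast hK
    have hK0 : (0 : ℝ) < K := by linarith
    have hP : (0 : ℝ) < ∏ k ∈ Finset.range K, (k.factorial : ℝ) :=
      Finset.prod_pos fun k _ => by exact_mod_cast k.factorial_pos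
    have hf : (0 : ℝ) < K.factorial := by exact_mod_cast K.factorial_pos
    rw [Finset.prod_range_succ, Real.log_mul hP.ne' hf.ne']
    have h1 := log_fact_ge K hK
    have h2 : Real.log ((K : ℝ) + 1) ≤ Real.log K + 1 / K := by
      have h3 := Real.log_le_sub_one_of_pos (show (0 : ℝ) < (K + 1) / K by positivity)
      rw [Real.log_div (by positivity) (by positivity)] at h3
      have : ((K : ℝ) + 1) / K - 1 = 1 / K := by field_simp; ring
      linarith
    have h4 : 0 ≤ Real.log (K : ℝ) := Real.log_nonneg hK'
    push_cast
    have h5 : ((K : ℝ) ^ 2 - 1) / 2 * Real.log ((K : ℝ) + 1) ≤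
        ((K : ℝ) ^ 2 - 1) / 2 * (Real.log K + 1 / K) :=
      mul_le_mul_of_nonneg_left h2 (by nlinarith)
    have h6 : ((K : ℝ) ^ 2 - 1) / 2 * (1 / K) ≤ K / 2 := by
      rw [mul_one_div, div_le_iff₀ hK0]
      nlinarith
    nlinarith

lemma exists_rho (p : ℕ) (hp : 1010 ≤ p) : ∃ ρ : ℕ, 18 * p ≤ (2 * ρ + 1) ^ 2 ∧
    135 ≤ 2 * ρ + 1 ∧ (2 * ρ - 1) ^ 2 < 18 * p := by
  classical
  have hex : ∃ ρ : ℕ, 18 * p ≤ (2 * ρ + 1) ^ 2 := ⟨9 * p, by nlinarith⟩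
  have h1 := Nat.find_spec hex
  have h2 : 135 ≤ 2 * Nat.find hex + 1 := by
    by_contra hlt
    have h3 : 2 * Nat.find hex + 1 ≤ 134 := by omega
    have := Nat.pow_le_pow_left h3 2
    omega
  refine ⟨Nat.find hex, h1, h2, ?_⟩
  have h3 := Nat.find_min hex (m := Nat.find hex - 1) (by omega)
  have h4 : 2 * (Nat.find hex - 1) + 1 = 2 * Nat.find hex - 1 := by omega
  rw [h4] at h3
  omega

lemma num_cond (p R S : ℕ) (a : ℝ) (ha : 43.5 ≤ a) (hR : 135 ≤ R)
    (hR1 : 18 * p ≤ R ^ 2) (hR2 : ((R : ℝ) - 2) ^ 2 < 18 * p) (hS2 : (S : ℝ) ≤ a + 2) :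
    Real.pi * Real.exp (-((p - 1) * a)) * ((p : ℝ) / (2 * R)) ^ R * (3 * R : ℝ) ^ (S * R) ≤ 1 := by
  have hRr : (135 : ℝ) ≤ R := by exact_mod_cast hR
  have hR1' : 18 * (p : ℝ) ≤ R ^ 2 := by exact_mod_cast hR1
  have hl := log_le_lin (3 * R : ℝ) (by positivity)
  have h1 : (p : ℝ) / (2 * R) ≤ R / 36 := by
    rw [div_le_div_iff₀ (by positivity) (by norm_num)]
    nlinarith
  have h2 : Real.pi * ((p : ℝ) / (2 * R)) ^ R ≤ (3 * R : ℝ) ^ R := by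
    have e1 : ((p : ℝ) / (2 * R)) ^ R ≤ (R / 36 : ℝ) ^ R := pow_le_pow_left₀ (by positivity) h1 R
    have e2 : (3 * R : ℝ) ^ R = 108 ^ R * (R / 36 : ℝ) ^ R := by
      rw [← mul_pow]; congr 1; ring
    have e3 : (4 : ℝ) ≤ 108 ^ R := by
      calc (4 : ℝ) ≤ 108 ^ 1 := by norm_num
        _ ≤ 108 ^ R := pow_le_pow_right₀ (by norm_num) (by omega)
    rw [e2]
    exact mul_le_mul (Real.pi_le_four.trans e3) e1 (by positivity) (by positivity)
  have h3 : (3 * R : ℝ) ^ R * (3 * R : ℝ) ^ (S * R) ≤ Real.exp ((p - 1) * a) := by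
    rw [← pow_add, ← Real.exp_log (show (0 : ℝ) < 3 * R by positivity), ← Real.exp_nat_mul]
    apply Real.exp_le_exp.2
    push_cast
    have hlog : 0 ≤ Real.log (3 * R : ℝ) := Real.log_nonneg (by linarith)
    have k1 : (1 + (S : ℝ)) ≤ 1.069 * a := by linarith
    have k2 : (R : ℝ) * (5 + 3 * R / 403) * 1.069 ≤ p - 1 := by nlinarith
    calc ((R : ℝ) + S * R) * Real.log (3 * R) = (1 + S) * (R * Real.log (3 * R)) := by ring
      _ ≤ (1.069 * a) * (R * (5 + 3 * R / 403)) := by gcongr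
      _ = a * ((R : ℝ) * (5 + 3 * R / 403) * 1.069) := by ring
      _ ≤ a * (p - 1) := mul_le_mul_of_nonneg_left k2 (by linarith)
      _ = _ := by ring
  calc _ = (Real.pi * ((p : ℝ) / (2 * R)) ^ R) * (3 * R : ℝ) ^ (S * R) * Real.exp (-((p - 1) * a)) := by
        ring
    _ ≤ ((3 * R : ℝ) ^ R * (3 * R : ℝ) ^ (S * R)) * Real.exp (-((p - 1) * a)) := by gcongr
    _ ≤ Real.exp ((p - 1) * a) * Real.exp (-((p - 1) * a)) := by gcongr
    _ = 1 := by rw [← Real.exp_add]; simp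

lemma log_X (X : ℝ) (hX : 0 < X) (h : X ≤ 1 / 43) : Real.log X ≤ -3.6 := by
  have h1 : Real.log X ≤ Real.log (1 / 43) := Real.log_le_log hX h
  have h2 : Real.log (1 / 43 : ℝ) = - Real.log 43 := by rw [one_div, Real.log_inv]
  have h3 : (18 : ℝ) ≤ Real.log (43 ^ 5) := by
    rw [Real.le_log_iff_exp_le (by norm_num)]
    have h3 : Real.exp 18 = Real.exp 1 ^ 18 := by rw [← Real.exp_nat_mul]; norm_num
    rw [h3]
    calc _ ≤ (2.7182818286 : ℝ) ^ 18 := pow_le_pow_left₀ (by positivity) Real.exp_one_lt_d9.le 18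
      _ ≤ _ := by norm_num
  rw [Real.log_pow] at h3
  push_cast at h3
  linarith

set_option maxHeartbeats 1000000 in
lemma num_final (p R ρ S K : ℕ) (a : ℝ) (hp : 1010 ≤ p) (ha : 43.5 ≤ a) (hR : 135 ≤ R)
    (hRρ : R = 2 * ρ + 1)
    (hR1 : 18 * p ≤ R ^ 2) (hS1 : a ≤ S) (hS : 44 ≤ S) (hK : K + K = S * R) :
    Real.exp a ^ ((S + 1) * (ρ * (ρ + 1))) *
      ((((K + K).factorial : ℝ) * ∏ n ∈ Finset.range (K + K), (2 * (((S + 1) * p / 2 : ℝ) / 2) ^ n)) *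
        ((K.factorial : ℝ) * (2 * (Real.pi / (2 * p)) ^ K / K.factorial) ^ K)) <
    (∏ k ∈ Finset.range K, (k.factorial : ℝ)) ^ 2 := by
  have hpr : (1010 : ℝ) ≤ p := by exact_mod_cast hp
  have hRr : (135 : ℝ) ≤ R := by exact_mod_cast hR
  have hR1' : 18 * (p : ℝ) ≤ R ^ 2 := by exact_mod_cast hR1
  have hSr : (44 : ℝ) ≤ S := by exact_mod_cast hS
  have hpi := Real.pi_pos
  have hKr : (K : ℝ) + K = S * R := by exact_mod_cast hK
  have hK2 : (2970 : ℝ) ≤ K := by nlinarith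
  have hK0 : (0 : ℝ) < K := by linarith
  have hKn : 1 ≤ K := by
    have : (1 : ℝ) ≤ K := by linarith
    exact_mod_cast this
  set b : ℝ := ((S + 1) * p / 2 : ℝ) / 2 with hb
  have hb1 : 1 ≤ b := by rw [hb]; nlinarith
  have hb0 : 0 < b := by linarith
  set c : ℝ := Real.pi / (2 * p) with hc
  have hc0 : 0 < c := by positivity
  have hf2 : (0 : ℝ) < (K + K).factorial := by exact_mod_cast (K + K).factorial_pos
  have hf : (0 : ℝ) < K.factorial := by exact_mod_cast K.factorial_pos
  have hP : (0 : ℝ) < ∏ k ∈ Finset.range K, (k.factorial : ℝ) :=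
    Finset.prod_pos fun k _ => by exact_mod_cast k.factorial_pos
  have hQ : (0 : ℝ) < ∏ n ∈ Finset.range (K + K), (2 * b ^ n) :=
    Finset.prod_pos fun k _ => by positivity
  have hQl : Real.log (∏ n ∈ Finset.range (K + K), (2 * b ^ n)) =
      2 * K * Real.log 2 + K * (2 * K - 1) * Real.log b := by
    rw [Real.log_prod (fun n _ => by positivity)]
    have e1 : ∀ n ∈ Finset.range (K + K), Real.log (2 * b ^ n) = Real.log 2 + n * Real.log b := by
      intro n _
      rw [Real.log_mul (by norm_num) (by positivity), Real.log_pow]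
    rw [Finset.sum_congr rfl e1, Finset.sum_add_distrib, ← Finset.sum_mul]
    have e2 : ∀ m : ℕ, ∑ n ∈ Finset.range m, (n : ℝ) = m * (m - 1) / 2 := by
      intro m
      induction m with
      | zero => simp
      | succ m ih => rw [Finset.sum_range_succ, ih]; push_cast; ring
    rw [e2]
    simp only [Finset.sum_const, Finset.card_range, nsmul_eq_mul]
    push_cast
    ring
  rw [← Real.log_lt_log_iff (by positivity) (by positivity)]
  rw [Real.log_mul (by positivity) (by positivity), Real.log_mul (by positivity) (by positivity),
    Real.log_mul hf2.ne' hQ.ne', Real.log_mul hf.ne' (by positivity), Real.log_pow, Real.log_pow,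
    Real.log_pow, Real.log_exp, hQl, Real.log_div (by positivity) hf.ne',
    Real.log_mul (by norm_num) (by positivity), Real.log_pow]
  have l1 := log_fact_le (K + K)
  have l2 := log_fact_le K
  have l3 := log_fact_ge K hKn
  have l4 := log_sf_ge K hKn
  have hl2K : Real.log ((K + K : ℕ) : ℝ) = Real.log 2 + Real.log K := by
    rw [show ((K + K : ℕ) : ℝ) = 2 * K by push_cast; ring, Real.log_mul (by norm_num) hK0.ne']
  rw [hl2K] at l1
  have l5 := log_le_lin (2 * K : ℝ) (by positivity)
  rw [Real.log_mul (by norm_num) hK0.ne'] at l5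
  have lb : 0 ≤ Real.log b := Real.log_nonneg hb1
  -- the main bracket
  have hbr : 2 * Real.log b + Real.log c - 2 * Real.log K ≤ -3.6 := by
    have hX := log_X (b ^ 2 * c / (K : ℝ) ^ 2) (by positivity) (by
      have hKe : (K : ℝ) = S * R / 2 := by linarith
      have e : b ^ 2 * c = (S + 1) ^ 2 * p * Real.pi / 32 := by
        rw [hb, hc]; field_simp; ring
      rw [div_le_div_iff₀ (by positivity) (by norm_num), e, hKe]
      have k1 : ((S : ℝ) + 1) ≤ 45 / 44 * S := by linarith
      have k2 : ((S : ℝ) + 1) ^ 2 ≤ (45 / 44 * S) ^ 2 := pow_le_pow_left₀ (by positivity) k1 2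
      have k3 : (p : ℝ) * Real.pi ≤ (R ^ 2 / 18) * 3.15 :=
        mul_le_mul (by linarith) Real.pi_lt_d2.le hpi.le (by positivity)
      have k4 : ((S : ℝ) + 1) ^ 2 * (p * Real.pi) ≤ (45 / 44 * S) ^ 2 * ((R ^ 2 / 18) * 3.15) :=
        mul_le_mul k2 k3 (by positivity) (by positivity)
      have k5 : 0 ≤ (S : ℝ) ^ 2 * R ^ 2 := by positivity
      nlinarith)
    rw [Real.log_div (by positivity) (by positivity), Real.log_mul (by positivity) (by positivity),
      Real.log_pow, Real.log_pow] at hX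
    push_cast at hX
    linarith
  have hM : (((S + 1) * (ρ * (ρ + 1)) : ℕ) : ℝ) * a ≤ 45 / 44 * (K : ℝ) ^ 2 := by
    have hRr2 : (R : ℝ) = 2 * ρ + 1 := by exact_mod_cast hRρ
    have hKe : (K : ℝ) = S * R / 2 := by linarith
    rw [hKe]
    push_cast
    have m1 : (ρ : ℝ) * (ρ + 1) ≤ R ^ 2 / 4 := by rw [hRr2]; linarith [sq_nonneg (ρ : ℝ)]
    have k1 : ((S : ℝ) + 1) ≤ 45 / 44 * S := by linarith
    calc ((S : ℝ) + 1) * (ρ * (ρ + 1)) * a ≤ (45 / 44 * S) * (R ^ 2 / 4) * S := by gcongr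
      _ = _ := by ring
  have hbrK : (K : ℝ) ^ 2 * (2 * Real.log b + Real.log c - 2 * Real.log K) ≤ (K : ℝ) ^ 2 * (-3.6) :=
    mul_le_mul_of_nonneg_left hbr (by positivity)
  have l3K := mul_le_mul_of_nonneg_left l3 hK0.le
  have l5K := mul_le_mul_of_nonneg_left l5 hK0.le
  have lbK := mul_nonneg hK0.le lb
  have l2K : 0 ≤ (K : ℝ) * Real.log 2 := mul_nonneg hK0.le (Real.log_nonneg (by norm_num))
  push_cast at l1 hM ⊢
  have hfin : 45 / 44 * (K : ℝ) ^ 2 + (K : ℝ) ^ 2 * (-3.6) + 5 / 2 * (K : ℝ) ^ 2 +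
      5 * (K * (5 + 2 * K / 403)) < 0 := by
    have : (K : ℝ) * 2970 ≤ K * K := mul_le_mul_of_nonneg_left hK2 hK0.le
    linarith
  linarith

lemma core_false (p : ℕ) (hp : p.Prime) (hp2 : 1010 ≤ p) (k : ℤ) (hk : ¬ (p : ℤ) ∣ k)
    (α : GaussianInt) (hα : α ≠ 0) (φ η a : ℝ)
    (hφ : GaussianInt.toComplex α =
      GaussianInt.toComplex (star α) * Complex.exp ((φ : ℂ) * Complex.I))
    (hη : p * φ = k * (Real.pi / 2) + η) (ha : 43.5 ≤ a)
    (hαa : ‖GaussianInt.toComplex α‖ = Real.exp a)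
    (hηb : |η| ≤ Real.pi * Real.exp (-((p - 1) * a))) : False := by
  obtain ⟨ρ, h1, h2, h3⟩ := exists_rho p hp2
  set R := 2 * ρ + 1 with hR
  have hp0 : (0 : ℝ) < p := by exact_mod_cast hp.pos
  have hR2 : ((R : ℝ) - 2) ^ 2 < 18 * p := by
    have e : ((2 * ρ - 1 : ℕ) : ℝ) = (R : ℝ) - 2 := by
      rw [hR, Nat.cast_sub (by omega)]
      push_cast
      ring
    rw [← e]
    exact_mod_cast h3
  obtain ⟨j, hj1, hj2⟩ : ∃ j : ℕ, a ≤ 2 * j ∧ 2 * (j : ℝ) ≤ a + 2 := by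
    refine ⟨⌈a / 2⌉₊, ?_, ?_⟩
    · have := Nat.le_ceil (a / 2); linarith
    · have := (Nat.ceil_lt_add_one (show 0 ≤ a / 2 by linarith)).le; linarith
  have hj : 22 ≤ j := by
    have : (21 : ℝ) < j := by linarith
    have : 21 < j := by exact_mod_cast this
    omega
  have hRr : (135 : ℝ) ≤ R := by exact_mod_cast h2
  have h2R : 2 * R ≤ p := by
    have hRR : 135 * (R : ℝ) ≤ R * R := mul_le_mul_of_nonneg_right hRr (by linarith)
    have h9 : 2 * (R : ℝ) ≤ p := by linarith
    exact_mod_cast h9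
  have hcore := core p ρ (2 * j) (j * R) hp k hk h2R (by positivity) (by ring) α hα φ η hφ hη (by
    have hn := num_cond p R (2 * j) a ha h2 h1 hR2 (by push_cast; linarith)
    rw [show j * R + j * R = 2 * j * R by ring]
    refine le_trans ?_ hn
    gcongr)
  rw [hαa] at hcore
  have hfin := num_final p R ρ (2 * j) (j * R) a hp2 ha h2 hR h1 (by push_cast; linarith) (by omega)
    (by ring)
  exact absurd hcore (not_le.2 hfin)

lemma parity_ne (p q m x y : ℕ) (u v : ℤ) (hp : p ≠ 0) (hoq : Odd q)
    (heq : x ^ 2 + q ^ (2 * m) = 2 * y ^ p) (hyuv : (y : ℤ) = u ^ 2 + v ^ 2) :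
    u - v ≠ 0 ∧ u + v ≠ 0 := by
  have key : u ^ 2 ≠ v ^ 2 := by
    intro h
    have hy : (2 : ℤ) ∣ y := ⟨v ^ 2, by rw [hyuv, h]; ring⟩
    have hy2 : 2 ∣ y := by exact_mod_cast hy
    obtain ⟨b, hb⟩ := hy2
    obtain ⟨n, rfl⟩ := Nat.exists_eq_succ_of_ne_zero hp
    have h4 : 2 * y ^ (n + 1) = 4 * (b * y ^ n) := by
      conv_lhs => rw [pow_succ, hb]
      rw [hb]
      ring
    obtain ⟨d, hd⟩ := hoq.pow (n := m)
    have hQ : q ^ (2 * m) = 4 * (d * d + d) + 1 := by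
      rw [mul_comm, pow_mul, hd]; ring
    rw [Nat.succ_eq_add_one, h4, hQ] at heq
    rcases Nat.even_or_odd' x with ⟨c, hc | hc⟩
    · have : x ^ 2 = 4 * (c * c) := by rw [hc]; ring
      omega
    · have : x ^ 2 = 4 * (c * c + c) + 1 := by rw [hc]; ring
      omega
  constructor
  · intro h
    apply key
    rw [show u = v by linarith]
  · intro h
    apply key
    rw [show u = -v by linarith]
    ring

lemma main_false (p q m x y : ℕ) (u v : ℤ) (hp : Nat.Prime p) (hq : Nat.Prime q)
    (hoq : Odd q) (heq : x ^ 2 + q ^ (2 * m) = 2 * y ^ p)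
    (hyuv : (y : ℤ) = u ^ 2 + v ^ 2)
    (hqG : (q : ℤ) ^ m = ((⟨1, 1⟩ : GaussianInt) * (⟨u, v⟩ : GaussianInt) ^ p).im)
    (hQ2 : ((q : ℤ) ^ m) ^ 2 ≤ 2 * (u ^ 2 + v ^ 2)) (hm : 40 ≤ m) (hp2 : 1010 ≤ p) : False := by
  obtain ⟨huv1, huv2⟩ := parity_ne p q m x y u v hp.ne_zero hoq heq hyuv
  set α : GaussianInt := ⟨u, v⟩ with hαd
  set A : ℂ := GaussianInt.toComplex α with hA
  have hAre : A.re = u := by simp [hA, hαd]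
  have hAim : A.im = v := by simp [hA, hαd]
  have hα : α ≠ 0 := by
    intro h
    have h1 := congrArg Zsqrtd.re h
    have h2 := congrArg Zsqrtd.im h
    simp [hαd] at h1 h2
    apply huv1
    rw [h1, h2]; simp
  have hA0 : A ≠ 0 := by rwa [Ne, hA, GaussianInt.toComplex_eq_zero]
  have hnp : 0 < ‖A‖ := norm_pos_iff.2 hA0
  set a : ℝ := Real.log ‖A‖ with ha_def
  have hexpa : ‖A‖ = Real.exp a := (Real.exp_log hnp).symm
  have hnA2 : ‖A‖ ^ 2 = (u : ℝ) ^ 2 + (v : ℝ) ^ 2 := by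
    rw [Complex.sq_norm, Complex.normSq_apply, hAre, hAim]; ring
  set Q : ℝ := (q : ℝ) ^ m with hQ
  have hQ2' : Q ^ 2 ≤ 2 * ‖A‖ ^ 2 := by
    rw [hnA2, hQ]
    exact_mod_cast hQ2
  have hq3 : 3 ≤ q := by
    rcases hoq with ⟨t, ht⟩
    have := hq.two_le
    omega
  have hQ3 : (3 : ℝ) ^ 40 ≤ Q := by
    have h3 : (3 : ℝ) ≤ q := by exact_mod_cast hq3
    calc (3 : ℝ) ^ 40 ≤ (q : ℝ) ^ 40 := pow_le_pow_left₀ (by norm_num) h3 _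
      _ ≤ Q := pow_le_pow_right₀ (by linarith) hm
  have hQ0 : 0 < Q := lt_of_lt_of_le (by positivity) hQ3
  have ha : 43.5 ≤ a := by
    have h1 : ((3 : ℝ) ^ 40) ^ 2 ≤ 2 * ‖A‖ ^ 2 := (pow_le_pow_left₀ (by positivity) hQ3 2).trans hQ2'
    have h2 : (87 : ℝ) ≤ Real.log (‖A‖ ^ 2) := by
      rw [Real.le_log_iff_exp_le (by positivity)]
      have h3 : Real.exp 87 = Real.exp 1 ^ 87 := by rw [← Real.exp_nat_mul]; norm_num
      rw [h3]
      have h4 : Real.exp 1 ^ 87 ≤ (2.7182818286 : ℝ) ^ 87 :=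
        pow_le_pow_left₀ (by positivity) Real.exp_one_lt_d9.le _
      have h5 : 2 * (2.7182818286 : ℝ) ^ 87 ≤ ((3 : ℝ) ^ 40) ^ 2 := by norm_num
      linarith
    rw [Real.log_pow] at h2
    push_cast at h2
    linarith
  set θ : ℝ := Complex.arg A with hθ
  have hpol : A = (‖A‖ : ℂ) * Complex.exp ((θ : ℂ) * Complex.I) :=
    (Complex.norm_mul_exp_arg_mul_I A).symm
  have hstar : GaussianInt.toComplex (star α) = (starRingEnd ℂ) A := by
    rw [GaussianInt.toComplex_star]
  have hφ : A = GaussianInt.toComplex (star α) * Complex.exp (((2 * θ : ℝ) : ℂ) * Complex.I) := by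
    rw [hstar]
    conv_rhs => rw [hpol]
    rw [map_mul, Complex.conj_ofReal, ← Complex.exp_conj, mul_assoc, ← Complex.exp_add, map_mul,
      Complex.conj_ofReal, Complex.conj_I]
    conv_lhs => rw [hpol]
    congr 2
    push_cast
    ring
  set ψ : ℝ := Real.pi / 4 + p * θ with hψ
  set l : ℤ := round (ψ / Real.pi) with hl
  have hpi := Real.pi_pos
  set η₁ : ℝ := ψ - l * Real.pi with hη₁
  have hη₁b : |η₁| ≤ Real.pi / 2 := by
    have := abs_sub_round (ψ / Real.pi)
    have e : η₁ = (ψ / Real.pi - l) * Real.pi := by rw [hη₁]; field_simp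
    rw [e, abs_mul, abs_of_pos hpi]
    rw [← hl] at this
    nlinarith
  have hsin1 := Real.mul_abs_le_abs_sin hη₁b
  have hsin2 : |Real.sin η₁| = |Real.sin ψ| := by
    rw [hη₁, Real.sin_sub_int_mul_pi, abs_mul]
    rcases Int.even_or_odd l with h | h
    · simp [h.neg_one_zpow]
    · simp [h.neg_one_zpow]
  have hIm : Q = ‖A‖ ^ p * (Real.sin (p * θ) + Real.cos (p * θ)) := by
    have h1 : (((q : ℤ) ^ m : ℤ) : ℝ) = ((1 + Complex.I) * A ^ p).im := by
      rw [hqG, GaussianInt.intCast_im, map_mul, map_pow]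
      congr 2
      simp [GaussianInt.toComplex_def']
    have h2 : A ^ p = ((‖A‖ ^ p : ℝ) : ℂ) * Complex.exp (((p * θ : ℝ) : ℂ) * Complex.I) := by
      conv_lhs => rw [hpol]
      rw [mul_pow, ← Complex.exp_nat_mul]
      push_cast
      ring_nf
    rw [h2] at h1
    have h3 : Q = (((q : ℤ) ^ m : ℤ) : ℝ) := by rw [hQ]; push_cast; rfl
    rw [h3, h1]
    simp only [Complex.mul_im, Complex.mul_re, Complex.add_re, Complex.add_im, Complex.one_re,
      Complex.one_im, Complex.I_re, Complex.I_im, Complex.ofReal_re, Complex.ofReal_im,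
      Complex.exp_ofReal_mul_I_re, Complex.exp_ofReal_mul_I_im]
    ring
  have hsinψ : Real.sin ψ = Real.sqrt 2 / 2 * (Real.sin (p * θ) + Real.cos (p * θ)) := by
    rw [hψ, Real.sin_add, Real.sin_pi_div_four, Real.cos_pi_div_four]
    ring
  have hs2 : Real.sqrt 2 ^ 2 = 2 := Real.sq_sqrt (by norm_num)
  have hs0 : 0 < Real.sqrt 2 := by positivity
  have hsinb : |Real.sin ψ| * ‖A‖ ^ (p - 1) ≤ 1 := by
    have e0 : ‖A‖ ^ p = ‖A‖ ^ (p - 1) * ‖A‖ := by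
      rw [← pow_succ]; congr 1; omega
    have e1 : |Real.sin ψ| * ‖A‖ ^ (p - 1) * (Real.sqrt 2 * ‖A‖) = Q := by
      have h5 : Real.sin ψ * ‖A‖ ^ (p - 1) * (Real.sqrt 2 * ‖A‖) = Q := by
        rw [hIm, hsinψ, e0]
        linear_combination (‖A‖ ^ (p - 1) * ‖A‖ * (Real.sin (p * θ) + Real.cos (p * θ)) / 2) * hs2
      have h6 : 0 ≤ Real.sin ψ := by
        by_contra hneg
        push Not at hneg
        have : Real.sin ψ * (‖A‖ ^ (p - 1) * (Real.sqrt 2 * ‖A‖)) < 0 :=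
          mul_neg_of_neg_of_pos hneg (by positivity)
        linarith
      rw [abs_of_nonneg h6]; exact h5
    have e2 : Q ≤ Real.sqrt 2 * ‖A‖ := by
      apply le_of_sq_le_sq _ (by positivity)
      rw [mul_pow, hs2]; exact hQ2'
    have e3 : 0 < Real.sqrt 2 * ‖A‖ := by positivity
    by_contra hgt
    push Not at hgt
    have := mul_lt_mul_of_pos_right hgt e3
    linarith
  have hexp : Real.exp (-((p - 1) * a)) = (‖A‖ ^ (p - 1))⁻¹ := by
    rw [Real.exp_neg, hexpa, ← Real.exp_nat_mul, Nat.cast_sub hp.one_le]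
    push_cast
    rfl
  have hηb : |2 * η₁| ≤ Real.pi * Real.exp (-((p - 1) * a)) := by
    rw [hexp]
    have h1 : |Real.sin ψ| ≤ (‖A‖ ^ (p - 1))⁻¹ := by
      rw [← one_div, le_div_iff₀ (by positivity)]
      exact hsinb
    rw [hsin2] at hsin1
    have h2 : |2 * η₁| = Real.pi * (2 / Real.pi * |η₁|) := by
      rw [abs_mul, abs_two]; field_simp
    rw [h2]
    exact mul_le_mul_of_nonneg_left (hsin1.trans h1) hpi.le
  have hηe : (p : ℝ) * (2 * θ) = ((4 * l - 1 : ℤ) : ℝ) * (Real.pi / 2) + 2 * η₁ := by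
    rw [hη₁, hψ]
    push_cast
    ring
  have hp0 : (0 : ℝ) < p := by exact_mod_cast hp.pos
  have hk : ¬ (p : ℤ) ∣ (4 * l - 1) := by
    rintro ⟨k', hk'⟩
    have hodd : Odd k' := by
      rcases Int.even_or_odd k' with ⟨c, hc⟩ | h
      · exfalso
        rw [hc] at hk'
        have : 4 * l - 1 = 2 * (p * c) := by rw [hk']; ring
        omega
      · exact h
    obtain ⟨j, hj⟩ := hodd
    have h1 : 2 * θ = (k' * (Real.pi / 2)) + 2 * η₁ / p := by
      rw [hk'] at hηe
      push_cast at hηe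
      field_simp
      field_simp at hηe
      linarith
    have h2 := exp_diff (k' * (Real.pi / 2)) (2 * η₁ / p)
    rw [← h1] at h2
    have h3 : Complex.exp (((k' * (Real.pi / 2) : ℝ) : ℂ) * Complex.I) = (-1 : ℂ) ^ j * Complex.I := by
      rw [hj]
      have : (((((2 * j + 1 : ℤ)) : ℝ) * (Real.pi / 2) : ℝ) : ℂ) * Complex.I =
          (j : ℂ) * ((Real.pi : ℂ) * Complex.I) + (Real.pi : ℂ) / 2 * Complex.I := by
        push_cast; ring
      rw [this, Complex.exp_add, Complex.exp_int_mul, Complex.exp_pi_mul_I,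
        Complex.exp_pi_div_two_mul_I]
    rw [h3] at h2
    have h4 : ‖A - (starRingEnd ℂ) A * ((-1 : ℂ) ^ j * Complex.I)‖ ≤ ‖A‖ * |2 * η₁ / p| := by
      have : A - (starRingEnd ℂ) A * ((-1 : ℂ) ^ j * Complex.I) = (starRingEnd ℂ) A *
          (Complex.exp (((2 * θ : ℝ) : ℂ) * Complex.I) - ((-1 : ℂ) ^ j * Complex.I)) := by
        rw [mul_sub, ← hstar, ← hφ]
      rw [this, norm_mul, RCLike.norm_conj]
      exact mul_le_mul_of_nonneg_left h2 (norm_nonneg _)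
    have h5 : (1 : ℝ) ≤ ‖A - (starRingEnd ℂ) A * ((-1 : ℂ) ^ j * Complex.I)‖ := by
      refine le_trans ?_ (Complex.abs_re_le_norm _)
      rcases Int.even_or_odd j with h | h
      · rw [h.neg_one_zpow]
        have : (A - (starRingEnd ℂ) A * (1 * Complex.I)).re = ((u - v : ℤ) : ℝ) := by
          simp [hAre, hAim]
        rw [this]
        exact_mod_cast Int.one_le_abs huv1
      · rw [h.neg_one_zpow]
        have : (A - (starRingEnd ℂ) A * (-1 * Complex.I)).re = ((u + v : ℤ) : ℝ) := by
          simp [hAre, hAim]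
        rw [this]
        exact_mod_cast Int.one_le_abs huv2
    have h6 : |2 * η₁ / p| ≤ Real.pi * Real.exp (-((p - 1) * a)) := by
      rw [abs_div, abs_of_pos hp0]
      refine (div_le_self (abs_nonneg _) ?_).trans hηb
      exact_mod_cast hp.one_le
    have h7 : ‖A‖ * |2 * η₁ / p| ≤ Real.exp a * (Real.pi * Real.exp (-((p - 1) * a))) := by
      rw [← hexpa]
      exact mul_le_mul_of_nonneg_left h6 hnp.le
    have h8 : Real.exp a * (Real.pi * Real.exp (-((p - 1) * a))) < 1 := by
      have e1 : Real.exp a * (Real.pi * Real.exp (-((p - 1) * a))) =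
          Real.pi * Real.exp (-((p - 2) * a)) := by
        rw [mul_left_comm, ← Real.exp_add]
        congr 2
        ring
      have hpr : (1010 : ℝ) ≤ p := by exact_mod_cast hp2
      have e2 : Real.pi < Real.exp ((p - 2) * a) := by
        have := Real.add_one_le_exp (((p : ℝ) - 2) * a)
        have := Real.pi_le_four
        nlinarith
      rw [e1, Real.exp_neg, ← div_eq_mul_inv, div_lt_one (Real.exp_pos _)]
      exact e2
    linarith
  exact core_false p hp hp2 (4 * l - 1) hk α hα (2 * θ) (2 * η₁) a hφ hηe ha hexpa hηb

theorem bound_p_large_m (p q m x y : ℕ) (u v : ℤ)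
    (hp : Nat.Prime p) (hop : Odd p) (hq : Nat.Prime q) (hoq : Odd q)
    (hm : 1 ≤ m) (hx : 0 < x) (hy : 0 < y) (hcop : Nat.gcd x y = 1)
    (heq : x ^ 2 + q ^ (2 * m) = 2 * y ^ p)
    (hyuv : (y : ℤ) = u ^ 2 + v ^ 2)
    (hxF : (x : ℤ) = Ffun p u v)
    (hqG : (q : ℤ) ^ m = Gfun p u v)
    (hsum : u + d4 p * v = (q : ℤ) ^ m ∨ u + d4 p * v = -(q : ℤ) ^ m) :
    (40 ≤ m → p ≤ 1309) ∧ (100 ≤ m → p ≤ 1093) ∧ (250 ≤ m → p ≤ 1009) := by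
  have hsq : (u + d4 p * v) ^ 2 = ((q : ℤ) ^ m) ^ 2 := by
    rcases hsum with h | h
    · rw [h]
    · rw [h]; ring
  have hQ2 : ((q : ℤ) ^ m) ^ 2 ≤ 2 * (u ^ 2 + v ^ 2) := by
    rw [← hsq]
    unfold d4
    split_ifs
    · nlinarith [sq_nonneg (u - v)]
    · nlinarith [sq_nonneg (u + v)]
  have key : 40 ≤ m → p ≤ 1009 := by
    intro hm40
    by_contra hlt
    exact main_false p q m x y u v hp hq hoq heq hyuv hqG hQ2 hm40 (by omega)
  refine ⟨fun h => ?_, fun h => ?_, fun h => ?_⟩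
  · have := key h; omega
  · have := key (by omega); omega
  · exact key (by omega)
end

section
/- The only solution (m, p, q, x) in positive integers m, p, q, x with p and q odd primes of the equation x² + q^(2m) = 2·17^p is (m, p, q, x) = (1, 3, 5, 99). -/
/-- The pair (c, d) with c + d i = (1+i)(4+i)^n. -/
def sq17 : ℕ → ℤ × ℤ
  | 0 => (1, 1)
  | n + 1 => (4 * (sq17 n).1 - (sq17 n).2, (sq17 n).1 + 4 * (sq17 n).2)

def c17 (n : ℕ) : ℤ := (sq17 n).1
def d17 (n : ℕ) : ℤ := (sq17 n).2

theorem c17_succ (n : ℕ) : c17 (n + 1) = 4 * c17 n - d17 n := rfl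
theorem d17_succ (n : ℕ) : d17 (n + 1) = c17 n + 4 * d17 n := rfl
theorem c17_zero : c17 0 = 1 := rfl
theorem d17_zero : d17 0 = 1 := rfl

theorem shift4 (n : ℕ) : c17 (n + 4) = 161 * c17 n - 240 * d17 n ∧
    d17 (n + 4) = 240 * c17 n + 161 * d17 n := by
  simp only [c17_succ, d17_succ, show n + 4 = n + 1 + 1 + 1 + 1 from rfl]
  constructor <;> ring

theorem odd17 (n : ℕ) : c17 n % 2 = 1 ∧ d17 n % 2 = 1 ∨ False := by
  left
  have hs : ∀ k, (c17 (2 * k) % 2 = 1 ∧ d17 (2 * k) % 2 = 1) ∧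
      (c17 (2 * k + 1) % 2 = 1 ∧ d17 (2 * k + 1) % 2 = 1) := by
    intro k
    induction k with
    | zero => decide
    | succ k ih =>
      have e : 2 * (k + 1) = 2 * k + 1 + 1 := by ring
      rw [e]
      simp only [c17_succ, d17_succ] at *
      omega
  rcases Nat.even_or_odd' n with ⟨k, rfl | rfl⟩
  · exact (hs k).1
  · exact (hs k).2

theorem shift_two_adic (j : ℕ) (hj : 0 < j) : ∃ t a b : ℤ, t ≠ 0 ∧ (j % 2 = 0 → ∃ s, t = 2 * s) ∧
    ∀ n, c17 (n + 4 * j) = c17 n + 16 * t * (2 * a * c17 n - (2 * b + 1) * d17 n) ∧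
      d17 (n + 4 * j) = d17 n + 16 * t * ((2 * b + 1) * c17 n + 2 * a * d17 n) := by
  induction j using Nat.strong_induction_on with
  | _ j ih =>
    rcases Nat.even_or_odd' j with ⟨i, rfl | rfl⟩
    · obtain ⟨t, a, b, ht, -, h⟩ := ih i (by omega) (by omega)
      refine ⟨2 * t, a + 4 * t * (4 * a ^ 2 - (2 * b + 1) ^ 2), b + 16 * t * a * (2 * b + 1),
        by simpa using ht, fun _ => ⟨t, rfl⟩, fun n => ?_⟩
      have h1 := h n
      have h2 := h (n + 4 * i)
      rw [h1.1, h1.2] at h2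
      rw [show n + 4 * (2 * i) = n + 4 * i + 4 * i by ring, h2.1, h2.2]
      constructor <;> ring
    · rcases Nat.eq_zero_or_pos i with rfl | hi
      · refine ⟨1, 5, 7, by norm_num, by norm_num, fun n => ?_⟩
        have h := shift4 n
        simp only [Nat.mul_zero, Nat.zero_add, Nat.mul_one]
        rw [h.1, h.2]
        constructor <;> ring
      · obtain ⟨t, a, b, ht, h0, h⟩ := ih (2 * i) (by omega) (by omega)
        obtain ⟨t, rfl⟩ := h0 (by omega)
        refine ⟨1, 5 + 2 * t * a + 16 * t * (20 * a - 15 * (2 * b + 1)),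
          7 + t * (2 * b + 1) + 16 * t * (30 * a + 10 * (2 * b + 1)), by norm_num, by omega,
          fun n => ?_⟩
        have h1 := h n
        have h2 := shift4 (n + 4 * (2 * i))
        rw [h1.1, h1.2] at h2
        rw [show n + 4 * (2 * i + 1) = n + 4 * (2 * i) + 4 by ring, h2.1, h2.2]
        constructor <;> ring

theorem inj17 (n j : ℕ) (hj : 0 < j) : c17 (n + 4 * j) ≠ c17 n ∧ d17 (n + 4 * j) ≠ d17 n := by
  obtain ⟨t, a, b, ht, -, h⟩ := shift_two_adic j hj
  obtain ⟨h1, h2⟩ := h n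
  have ho := (odd17 n).resolve_right id
  obtain ⟨u, hu⟩ : ∃ u, c17 n = 2 * u + 1 := ⟨c17 n / 2, by omega⟩
  obtain ⟨v, hv⟩ : ∃ v, d17 n = 2 * v + 1 := ⟨d17 n / 2, by omega⟩
  constructor
  · intro e
    have : t * (2 * a * c17 n - (2 * b + 1) * d17 n) = 0 := by linarith
    rcases mul_eq_zero.1 this with h | h
    · exact ht h
    · rw [hu, hv] at h
      have : 2 * (a * (2 * u + 1) - 2 * b * v - b - v) = 1 := by linarith
      omega
  · intro e
    have : t * ((2 * b + 1) * c17 n + 2 * a * d17 n) = 0 := by linarith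
    rcases mul_eq_zero.1 this with h | h
    · exact ht h
    · rw [hu, hv] at h
      have : 2 * (a * (2 * v + 1) + 2 * b * u + b + u) = -1 := by linarith
      omega

theorem mod1 (j : ℕ) : c17 (1 + 4 * j) % 240 % 80 = 3 ∧ c17 (1 + 4 * j) % 3 = 0 ∧
    d17 (1 + 4 * j) % 80 = 5 := by
  induction j with
  | zero => decide
  | succ j ih =>
    have h := shift4 (1 + 4 * j)
    rw [show 1 + 4 * (j + 1) = 1 + 4 * j + 4 by ring]
    omega

theorem mod3 (j : ℕ) : c17 (3 + 4 * j) % 80 = 5 ∧ d17 (3 + 4 * j) % 3 = 0 ∧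
    d17 (3 + 4 * j) % 80 = 19 := by
  induction j with
  | zero => decide
  | succ j ih =>
    have h := shift4 (3 + 4 * j)
    rw [show 3 + 4 * (j + 1) = 3 + 4 * j + 4 by ring]
    omega

theorem shift24 (n : ℕ) : c17 (n + 24) % 9 = c17 n % 9 ∧ d17 (n + 24) % 9 = d17 n % 9 := by
  have h1 := shift4 n
  have h2 := shift4 (n + 4)
  have h3 := shift4 (n + 8)
  have h4 := shift4 (n + 12)
  have h5 := shift4 (n + 16)
  have h6 := shift4 (n + 20)
  simp only [Nat.add_assoc, Nat.reduceAdd] at *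
  omega

theorem shift20 (n : ℕ) : c17 (n + 20) % 25 = c17 n % 25 ∧ d17 (n + 20) % 25 = d17 n % 25 := by
  have h1 := shift4 n
  have h2 := shift4 (n + 4)
  have h3 := shift4 (n + 8)
  have h4 := shift4 (n + 12)
  have h5 := shift4 (n + 16)
  simp only [Nat.add_assoc, Nat.reduceAdd] at *
  omega

theorem per9 (r k : ℕ) : c17 (r + 24 * k) % 9 = c17 r % 9 ∧ d17 (r + 24 * k) % 9 = d17 r % 9 := by
  induction k with
  | zero => simp
  | succ k ih =>
    have h := shift24 (r + 24 * k)
    rw [show r + 24 * (k + 1) = r + 24 * k + 24 by ring]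
    omega

theorem per25 (r k : ℕ) :
    c17 (r + 20 * k) % 25 = c17 r % 25 ∧ d17 (r + 20 * k) % 25 = d17 r % 25 := by
  induction k with
  | zero => simp
  | succ k ih =>
    have h := shift20 (r + 20 * k)
    rw [show r + 20 * (k + 1) = r + 20 * k + 20 by ring]
    omega

theorem nine (n : ℕ) (hn : n % 2 = 1) (h : c17 n % 9 = 0 ∨ d17 n % 9 = 0) : n % 3 = 0 := by
  have key : ∀ r < 24, r % 2 = 1 → (c17 r % 9 = 0 ∨ d17 r % 9 = 0) → r % 3 = 0 := by decide
  have hp := per9 (n % 24) (n / 24)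
  rw [Nat.mod_add_div] at hp
  rw [hp.1, hp.2] at h
  have := key (n % 24) (Nat.mod_lt _ (by norm_num)) (by omega) h
  omega

theorem twentyfive (n : ℕ) (hn : n % 2 = 1) (h : c17 n % 25 = 0 ∨ d17 n % 25 = 0) : n % 5 = 0 := by
  have key : ∀ r < 20, r % 2 = 1 → (c17 r % 25 = 0 ∨ d17 r % 25 = 0) → r % 5 = 0 := by decide
  have hp := per25 (n % 20) (n / 20)
  rw [Nat.mod_add_div] at hp
  rw [hp.1, hp.2] at h
  have := key (n % 20) (Nat.mod_lt _ (by norm_num)) (by omega) h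
  omega

theorem descent (n : ℕ) : ∀ x y : ℤ, x ^ 2 + y ^ 2 = 2 * 17 ^ n →
    (n = 0 ∨ (17 ∣ x - 4 * y ∧ ¬ 17 ∣ y)) →
    (x = c17 n ∧ y = d17 n) ∨ (x = - c17 n ∧ y = - d17 n) ∨
    (x = d17 n ∧ y = - c17 n) ∨ (x = - d17 n ∧ y = c17 n) := by
  induction n with
  | zero =>
    intro x y h _
    simp only [c17_zero, d17_zero]
    have h1 : x ≤ 1 := by nlinarith [sq_nonneg y]
    have h2 : -1 ≤ x := by nlinarith [sq_nonneg y]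
    have h3 : y ≤ 1 := by nlinarith [sq_nonneg x]
    have h4 : -1 ≤ y := by nlinarith [sq_nonneg x]
    interval_cases x <;> interval_cases y <;> simp_all
  | succ n ih =>
    intro x y h h'
    obtain ⟨⟨k, hk⟩, hy⟩ := h'.resolve_left (by omega)
    obtain rfl : x = 4 * y + 17 * k := by linarith
    have hn : (y + 4 * k) ^ 2 + (-k) ^ 2 = 2 * 17 ^ n := by
      have e : (17 : ℤ) ^ (n + 1) = 17 * 17 ^ n := by ring
      rw [e] at h
      nlinarith
    have := ih (y + 4 * k) (-k)
    have h2 : ∀ a b : ℤ, 4 * y + 17 * k = 4 * (y + 4 * k) - (-k) := by intros; ring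
    have h3 := this (by linarith) ?_
    · rw [c17_succ, d17_succ]
      omega
    · rcases Nat.eq_zero_or_pos n with h0 | h0
      · exact Or.inl h0
      · right
        have hd : (17 : ℤ) ∣ (y + 4 * k - 4 * (-k)) * y := by
          have e : (y + 4 * k - 4 * (-k)) * y = 2 * 17 ^ n - 17 * k ^ 2 := by
            rw [← hn]; ring
          rw [e]
          exact dvd_sub (Dvd.dvd.mul_left (dvd_pow_self _ (by omega)) _) (Dvd.intro _ rfl)
        have hp : Prime (17 : ℤ) := by norm_num
        have h4 := (hp.dvd_or_dvd hd).resolve_right hy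
        refine ⟨h4, fun h5 => hy ?_⟩
        omega

theorem repr17 (n : ℕ) (hn : 0 < n) (x y : ℤ) (h : x ^ 2 + y ^ 2 = 2 * 17 ^ n) (hy : ¬ 17 ∣ y) :
    (x.natAbs = (c17 n).natAbs ∧ y.natAbs = (d17 n).natAbs) ∨
    (x.natAbs = (d17 n).natAbs ∧ y.natAbs = (c17 n).natAbs) := by
  have hp : Prime (17 : ℤ) := by norm_num
  have hd : (17 : ℤ) ∣ (x - 4 * y) * (x + 4 * y) := by
    have e : (x - 4 * y) * (x + 4 * y) = 2 * 17 ^ n - 17 * y ^ 2 := by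
      rw [← h]; ring
    rw [e]
    exact dvd_sub (Dvd.dvd.mul_left (dvd_pow_self _ (by omega)) _) (Dvd.intro _ rfl)
  rcases hp.dvd_or_dvd hd with h1 | h1
  · have := descent n x y h (Or.inr ⟨h1, hy⟩)
    omega
  · have := descent n (-x) y (by rw [neg_sq]; exact h) (Or.inr ⟨by omega, hy⟩)
    omega

theorem no17 (m : ℕ) : ∀ k x : ℕ, x ^ 2 + 17 ^ (2 * m) ≠ 2 * 17 ^ (2 * k + 1) := by
  induction m with
  | zero =>
    intro k x h
    have h1 : 17 ^ (2 * k + 1) % 9 = 8 := by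
      rw [pow_succ, pow_mul, Nat.mul_mod, Nat.pow_mod]; norm_num
    have h2 : x ^ 2 % 9 = 6 := by
      simp only [Nat.mul_zero, pow_zero] at h
      omega
    have h3 : x % 9 < 9 := Nat.mod_lt _ (by norm_num)
    rw [Nat.pow_mod] at h2
    interval_cases x % 9 <;> simp at h2
  | succ m ih =>
    intro k x h
    rcases k with _ | k
    · have : 0 < 17 ^ (2 * m) := by positivity
      rw [show 2 * (m + 1) = 2 * m + 2 by ring, pow_add] at h
      norm_num at h
      nlinarith
    · rw [show 2 * (m + 1) = 2 * m + 2 by ring, show 2 * (k + 1) + 1 = 2 * k + 1 + 2 by ring,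
        pow_add, pow_add 17 (2 * k + 1)] at h
      have hx : 17 ∣ x := by
        apply Nat.Prime.dvd_of_dvd_pow (n := 2) (by norm_num)
        omega
      obtain ⟨z, rfl⟩ := hx
      apply ih k z
      rw [mul_pow] at h
      omega

theorem pow_mod_aux (q a : ℕ) (hq : q.Prime) (ha : a.Prime) (m : ℕ) (h : a ∣ q ^ m) : q = a :=
  ((Nat.prime_dvd_prime_iff_eq ha hq).1 (ha.dvd_of_dvd_pow h)).symm

theorem main17 (m p q : ℕ) (hm : 0 < m) (hp : p.Prime) (hpo : p % 2 = 1) (hq : q.Prime)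
    (h : q ^ m = (c17 p).natAbs ∨ q ^ m = (d17 p).natAbs) : m = 1 ∧ p = 3 ∧ q = 5 := by
  have hq35 : q = 3 ∨ q = 5 := by
    have hd : 3 ∣ q ^ m ∨ 5 ∣ q ^ m := by
      obtain ⟨j, hj⟩ : ∃ j, p = 1 + 4 * j ∨ p = 3 + 4 * j := ⟨p / 4, by omega⟩
      rcases hj with rfl | rfl
      · have := mod1 j
        omega
      · have := mod3 j
        omega
    rcases hd with hd | hd
    · exact Or.inl (pow_mod_aux q 3 hq (by norm_num) m hd)
    · exact Or.inr (pow_mod_aux q 5 hq (by norm_num) m hd)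
  have hp1 : p ≠ 1 := hp.ne_one
  have c3 : c17 3 = 5 := by decide
  have d3 : d17 3 = 99 := by decide
  have c5 : c17 5 = -717 := by decide
  have d5 : d17 5 = 1525 := by decide
  have c1 : c17 1 = 3 := by decide
  have d1 : d17 1 = 5 := by decide
  have hm1 : m = 1 := by
    by_contra hne
    obtain ⟨k, rfl⟩ : ∃ k, m = k + 2 := ⟨m - 2, by omega⟩
    rcases hq35 with rfl | rfl
    · have e : 3 ^ (k + 2) = 9 * 3 ^ k := by ring
      have h3 : p % 3 = 0 := nine p hpo (by omega)
      have : p = 3 := ((Nat.prime_dvd_prime_iff_eq (by norm_num) hp).1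
        (Nat.dvd_of_mod_eq_zero h3)).symm
      subst this
      rw [c3, d3] at h
      have : 11 ∣ 3 ^ (k + 2) := by omega
      have := pow_mod_aux 3 11 (by norm_num) (by norm_num) _ this
      omega
    · have e : 5 ^ (k + 2) = 25 * 5 ^ k := by ring
      have h3 : p % 5 = 0 := twentyfive p hpo (by omega)
      have : p = 5 := ((Nat.prime_dvd_prime_iff_eq (by norm_num) hp).1
        (Nat.dvd_of_mod_eq_zero h3)).symm
      subst this
      rw [c5, d5] at h
      have : 61 ∣ 5 ^ (k + 2) := by omega
      have := pow_mod_aux 5 61 (by norm_num) (by norm_num) _ this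
      omega
  subst hm1
  rw [pow_one] at h
  obtain ⟨j, hj⟩ : ∃ j, p = 1 + 4 * j ∨ p = 3 + 4 * j := ⟨p / 4, by omega⟩
  rcases hj with rfl | rfl
  · exfalso
    have h1 := mod1 j
    have h2 := inj17 1 j (by omega)
    omega
  · have h1 := mod3 j
    rcases Nat.eq_zero_or_pos j with rfl | hj
    · rw [show 3 + 4 * 0 = 3 from rfl, c3, d3] at h
      refine ⟨rfl, rfl, ?_⟩
      omega
    · exfalso
      have h2 := inj17 3 j hj
      omega

/-- The only solution `(m, p, q, x)` in positive integers with `p, q` odd primes of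
`x² + q^(2m) = 2·17^p` is `(1, 3, 5, 99)`. -/
theorem eq_fixed_y_seventeen (m p q x : ℕ) :
    (0 < m ∧ 0 < x ∧ Nat.Prime p ∧ Odd p ∧ Nat.Prime q ∧ Odd q ∧
      x ^ 2 + q ^ (2 * m) = 2 * 17 ^ p) ↔ (m, p, q, x) = (1, 3, 5, 99) := by
  constructor
  · rintro ⟨hm, hx, hp, hpo, hq, hqo, h⟩
    have hpo' : p % 2 = 1 := Nat.odd_iff.1 hpo
    by_cases h17 : 17 ∣ q ^ m
    · obtain rfl := pow_mod_aux q 17 hq (by norm_num) m h17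
      obtain ⟨k, rfl⟩ := hpo
      exact absurd h (no17 m k x)
    · have hz : (x : ℤ) ^ 2 + ((q ^ m : ℕ) : ℤ) ^ 2 = 2 * 17 ^ p := by
        have h' : x ^ 2 + (q ^ m) ^ 2 = 2 * 17 ^ p := by
          rw [← h, ← pow_mul, mul_comm m 2]
        exact_mod_cast h'
      have hr := repr17 p hp.pos x ((q ^ m : ℕ) : ℤ) hz (by exact_mod_cast h17)
      rw [Int.natAbs_natCast, Int.natAbs_natCast] at hr
      obtain ⟨rfl, rfl, rfl⟩ := main17 m p q hm hp hpo' hq (by tauto)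
      have : x = 99 := by
        norm_num at h
        nlinarith
      rw [this]
  · intro h
    simp only [Prod.mk.injEq] at h
    obtain ⟨rfl, rfl, rfl, rfl⟩ := h
    refine ⟨by norm_num, by norm_num, by norm_num, by decide, by norm_num, by decide, by norm_num⟩
end
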